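/- arXiv:1412.4627 — 4 statements merged into one kernel-verified Lean document; each statement's English description precedes it below -/
import Mathlib

section
/- Let (H, φ) be a finite linked group. Let A be a non-degenerate linking matrix of size n and B a non-degenerate linking matrix of size m. Assume there exist an A-presentation γ = (γ₁, …, γₙ) of H and a B-presentation η = (η₁, …, η_m) of H. Then there exist integers p, q ≥ 0 with n + p = m + q =: N, a stabilization Ã = diag(D_A, A) of A and a stabilization B̃ = diag(D_B, B) of B, both of size N, and a unimodular N×N matrix P such that Ã = Pᵀ B̃ P and, computing in the ℤ-module H^N, P·γ' = η', where γ' = (0, …, 0, γ₁, …, γₙ) ∈ H^N and η' = (0, …, 0, η₁, …, η_m) ∈ H^N. -/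
open Matrix

noncomputable section

/-- The group `ℚ/ℤ`. -/
abbrev QZ : Type := AddCircle (1 : ℚ)

/-- The rational matrix obtained from an integer matrix. -/
def mQ {k l : ℕ} (M : Matrix (Fin k) (Fin l) ℤ) : Matrix (Fin k) (Fin l) ℚ :=
  M.map (fun a => (a : ℚ))

/-- An `A`-presentation of a (finite) linked group `(H, φ)` for a non-degenerate
linking matrix `A`: the map `ℤᵏ → H` sending the `i`-th standard basis vector to
`η i` is surjective with kernel the image (column space) of `A`, and
`φ (η i) (η j)` is the class of `(A⁻¹) i j` in `ℚ/ℤ`. -/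
def IsPresentation {k : ℕ} {H : Type} [AddCommGroup H]
    (φ : H → H → QZ) (A : Matrix (Fin k) (Fin k) ℤ) (η : Fin k → H) : Prop :=
  (Function.Surjective fun v : Fin k → ℤ => ∑ i, v i • η i) ∧
  (∀ v : Fin k → ℤ, (∑ i, v i • η i) = 0 ↔ ∃ w, v = A *ᵥ w) ∧
  (∀ i j, φ (η i) (η j) = (((mQ A)⁻¹ i j : ℚ) : QZ))


set_option linter.all false
structure ZLat where
  M : Type
  [grp : AddCommGroup M]
  [fr : Module.Free ℤ M]
  [fin : Module.Finite ℤ M]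
  B : M →ₗ[ℤ] M →ₗ[ℤ] ℤ
  symm : ∀ x y, B x y = B y x

namespace ZLat
attribute [instance] ZLat.grp ZLat.fr ZLat.fin

def Uni (L : ZLat) : Prop := Function.Surjective L.B

def prod (L K : ZLat) : ZLat where
  M := L.M × K.M
  B := L.B.compl₁₂ (LinearMap.fst ℤ L.M K.M) (LinearMap.fst ℤ L.M K.M) +
    K.B.compl₁₂ (LinearMap.snd ℤ L.M K.M) (LinearMap.snd ℤ L.M K.M)
  symm x y := by simp [L.symm x.1, K.symm x.2]

@[simp] theorem prod_B (L K : ZLat) (x y : L.M × K.M) :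
    (L.prod K).B x y = L.B x.1 y.1 + K.B x.2 y.2 := rfl

def neg (L : ZLat) : ZLat where
  M := L.M
  B := -L.B
  symm x y := by simp [L.symm x y]

@[simp] theorem neg_B (L : ZLat) (x y : L.M) : L.neg.B x y = - L.B x y := rfl

def sub (L : ZLat) (N : Submodule ℤ L.M) : ZLat where
  M := N
  B := L.B.compl₁₂ N.subtype N.subtype
  symm x y := by simp [L.symm x.1]

@[simp] theorem sub_B (L : ZLat) (N : Submodule ℤ L.M) (x y : N) :
    (L.sub N).B x y = L.B x y := rfl

def ofMat {ι : Type} [Fintype ι] [DecidableEq ι] (A : Matrix ι ι ℤ) (h : A.IsSymm) : ZLat where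
  M := ι → ℤ
  B := Matrix.toLinearMap₂' ℤ A
  symm x y := by
    rw [Matrix.toLinearMap₂'_apply', Matrix.toLinearMap₂'_apply', Matrix.dotProduct_mulVec,
      dotProduct_comm, ← Matrix.mulVec_transpose, h]

@[simp] theorem ofMat_B {ι : Type} [Fintype ι] [DecidableEq ι] (A : Matrix ι ι ℤ) (h : A.IsSymm)
    (x y : ι → ℤ) : (ofMat A h).B x y = x ⬝ᵥ A *ᵥ y := Matrix.toLinearMap₂'_apply' _ _ _

def dg {ι : Type} [Fintype ι] [DecidableEq ι] (D : ι → ℤ) : ZLat :=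
  ofMat (Matrix.diagonal D) (Matrix.isSymm_diagonal D)

theorem dg_B {ι : Type} [Fintype ι] [DecidableEq ι] (D : ι → ℤ)
    (x y : ι → ℤ) : (dg D).B x y = ∑ i, D i * x i * y i := by
  refine (ofMat_B _ _ _ _).trans ?_
  simp only [dotProduct, Matrix.mulVec_diagonal]
  exact Finset.sum_congr rfl fun i _ => by ring

def Iso (L K : ZLat) : Prop := ∃ e : L.M ≃ₗ[ℤ] K.M, ∀ x y, K.B (e x) (e y) = L.B x y

theorem Iso.refl (L : ZLat) : Iso L L := ⟨LinearEquiv.refl _ _, fun _ _ => rfl⟩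
theorem Iso.symm' {L K : ZLat} : Iso L K → Iso K L := fun ⟨e, h⟩ =>
  ⟨e.symm, fun x y => by rw [← h]; simp⟩
theorem Iso.trans {L K J : ZLat} : Iso L K → Iso K J → Iso L J := fun ⟨e, h⟩ ⟨f, g⟩ =>
  ⟨e.trans f, fun x y => by simp [g, h]⟩
theorem Iso.prod {L K L' K' : ZLat} : Iso L K → Iso L' K' → Iso (L.prod L') (K.prod K') :=
  fun ⟨e, h⟩ ⟨f, g⟩ => ⟨LinearEquiv.prodCongr e f, fun x y => by
    change K.B (e x.1) (e y.1) + K'.B (f x.2) (f y.2) = _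
    rw [h, g]; rfl⟩
theorem Iso.comm (L K : ZLat) : Iso (L.prod K) (K.prod L) :=
  ⟨LinearEquiv.prodComm ℤ L.M K.M, fun x y => add_comm _ _⟩
theorem Iso.assoc (L K J : ZLat) : Iso ((L.prod K).prod J) (L.prod (K.prod J)) :=
  ⟨LinearEquiv.prodAssoc ℤ L.M K.M J.M, fun x y => (add_assoc _ _ _).symm⟩
theorem Iso.neg {L K : ZLat} : Iso L K → Iso L.neg K.neg := fun ⟨e, h⟩ =>
  ⟨e, fun x y => congrArg Neg.neg (h x y)⟩
theorem Iso.lcomm (L K J : ZLat) : Iso (L.prod (K.prod J)) (K.prod (L.prod J)) :=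
  (Iso.assoc _ _ _).symm'.trans (((Iso.comm _ _).prod (Iso.refl _)).trans (Iso.assoc _ _ _))

theorem Iso.dgSum {ι κ : Type} [Fintype ι] [DecidableEq ι] [Fintype κ] [DecidableEq κ]
    (D : ι → ℤ) (E : κ → ℤ) : Iso (dg (Sum.elim D E)) ((dg D).prod (dg E)) :=
  ⟨LinearEquiv.sumArrowLequivProdArrow ι κ ℤ ℤ, fun x y =>
    (congrArg₂ (· + ·) (dg_B D _ _) (dg_B E _ _)).trans
      (((dg_B (Sum.elim D E) x y).trans (Fintype.sum_sum_type _)).symm)⟩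

/-- diagonal lattice with entries `±1` -/
def IsD (L : ZLat) : Prop := ∃ (n : ℕ) (D : Fin n → ℤ), (∀ i, D i = 1 ∨ D i = -1) ∧ Iso L (dg D)

theorem IsD.mk {ι : Type} [Fintype ι] [DecidableEq ι] (D : ι → ℤ) (h : ∀ i, D i = 1 ∨ D i = -1)
    {L : ZLat} (hL : Iso L (dg D)) : IsD L := by
  refine ⟨Fintype.card ι, D ∘ (Fintype.equivFin ι).symm, fun i => h _, hL.trans ?_⟩
  refine ⟨LinearEquiv.funCongrLeft ℤ ℤ (Fintype.equivFin ι).symm, fun x y =>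
    (dg_B _ _ _).trans (Eq.trans ?_ (dg_B D x y).symm)⟩
  exact Fintype.sum_equiv (Fintype.equivFin ι).symm _ _ fun i => rfl

theorem IsD.iso {L K : ZLat} (h : Iso L K) : IsD K → IsD L := fun ⟨n, D, hD, e⟩ =>
  ⟨n, D, hD, h.trans e⟩

theorem IsD.prod {L K : ZLat} : IsD L → IsD K → IsD (L.prod K) := fun ⟨n, D, hD, e⟩ ⟨m, E, hE, f⟩ =>
  IsD.mk (Sum.elim D E) (by rintro (i | i) <;> simp [hD, hE])
    ((e.prod f).trans (Iso.dgSum D E).symm')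

theorem IsD.neg {L : ZLat} : IsD L → IsD L.neg := fun ⟨n, D, hD, e⟩ =>
  IsD.mk (-D) (fun i => by rcases hD i with h | h <;> simp [h]) (e.neg.trans
    ⟨LinearEquiv.refl _ _, fun x y =>
      (dg_B (-D) x y).trans (Eq.trans (by simp [Finset.sum_neg_distrib])
        (congrArg Neg.neg (dg_B D x y)).symm)⟩)

def SD (L : ZLat) : Prop := ∃ K, IsD K ∧ IsD (K.prod L)

theorem SD.iso {L K : ZLat} (h : Iso L K) : SD K → SD L := fun ⟨J, hJ, hK⟩ =>
  ⟨J, hJ, hK.iso ((Iso.refl _).prod h)⟩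

theorem IsD.empty : IsD (dg (fun i : Fin 0 => 0)) := IsD.mk _ (fun i => i.elim0) (Iso.refl _)

theorem IsD.sd {L : ZLat} (h : IsD L) : SD L := ⟨_, IsD.empty, IsD.empty.prod h⟩

theorem SD.prod {L K : ZLat} : SD L → SD K → SD (L.prod K) := fun ⟨J, hJ, hL⟩ ⟨J', hJ', hK⟩ =>
  ⟨J.prod J', hJ.prod hJ', (hL.prod hK).iso <| by
    refine (Iso.assoc _ _ _).trans (Iso.trans ?_ (Iso.assoc _ _ _).symm')
    exact (Iso.refl _).prod (Iso.lcomm _ _ _)⟩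

theorem SD.neg {L : ZLat} : SD L → SD L.neg := fun ⟨J, hJ, hL⟩ =>
  ⟨J.neg, hJ.neg, IsD.iso (K := (J.prod L).neg) ⟨LinearEquiv.refl ℤ (J.M × L.M), fun x y =>
    neg_add (J.B x.1 y.1) (L.B x.2 y.2)⟩ hL.neg⟩

theorem SD.of_prod {L K : ZLat} : SD (L.prod K) → SD K → SD L := fun ⟨J, hJ, hL⟩ ⟨J', hJ', hK⟩ =>
  ⟨J.prod (J'.prod K), hJ.prod hK, (hJ'.prod hL).iso <| by
    refine (((Iso.lcomm _ _ _).prod (Iso.refl _)).trans (Iso.assoc _ _ _)).trans ?_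
    refine (Iso.refl _).prod ((Iso.assoc _ _ _).trans ?_)
    exact (Iso.refl _).prod (Iso.comm _ _)⟩

end ZLat

namespace ZLat

theorem exists_prim {M : Type} [AddCommGroup M] [Module.Free ℤ M] [Module.Finite ℤ M]
    (v : M) (hv : v ≠ 0) : ∃ (d : ℤ) (v' : M) (f : M →ₗ[ℤ] ℤ), d ≠ 0 ∧ v = d • v' ∧ f v' = 1 := by
  let b := Module.Free.chooseBasis ℤ M
  let I : Submodule ℤ ℤ := LinearMap.range (LinearMap.applyₗ (R := ℤ) (M₂ := ℤ) v)
  obtain ⟨d, hd⟩ := (inferInstance : I.IsPrincipal)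
  have hdvd : ∀ i, d ∣ b.repr v i := by
    intro i
    have : b.repr v i ∈ I := ⟨b.coord i, rfl⟩
    rw [hd, Submodule.mem_span_singleton] at this
    obtain ⟨a, ha⟩ := this
    exact ⟨a, by rw [← ha, smul_eq_mul, mul_comm]⟩
  choose c hc using hdvd
  have hvv : v = d • ∑ i, c i • b i := by
    rw [Finset.smul_sum]
    conv_lhs => rw [← b.sum_repr v]
    exact Finset.sum_congr rfl fun i _ => by rw [hc, mul_smul]
  have hd0 : d ≠ 0 := by
    rintro rfl
    apply hv; rw [hvv, zero_smul]
  have : d ∈ I := by rw [hd]; exact Submodule.mem_span_singleton_self d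
  obtain ⟨f, hf⟩ := this
  refine ⟨d, _, f, hd0, hvv, ?_⟩
  have h1 : f v = d := hf
  rw [hvv, map_smul, smul_eq_mul] at h1
  exact mul_left_cancel₀ hd0 (h1.trans (mul_one d).symm)

theorem split_gen (X K : ZLat) (i : K.M →ₗ[ℤ] X.M) (π : X.M →ₗ[ℤ] K.M)
    (h1 : ∀ k, π (i k) = k) (h2 : ∀ k x, X.B (i k) x = K.B k (π x)) :
    ∃ e : X.M ≃ₗ[ℤ] K.M × LinearMap.ker π,
      (∀ x y, K.B (e x).1 (e y).1 + X.B (e x).2 (e y).2 = X.B x y) ∧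
      (∀ x, (e x).1 = π x) ∧ (∀ x, ((e x).2 : X.M) = x - i (π x)) := by
  let pr : X.M →ₗ[ℤ] LinearMap.ker π := LinearMap.codRestrict (LinearMap.ker π)
    (LinearMap.id - i.comp π) (by intro x; simp [h1])
  have hpr : ∀ x, (pr x : X.M) = x - i (π x) := by intro x; simp [pr]
  have hN0 : ∀ x : LinearMap.ker π, π x = 0 := fun x => x.2
  let e : X.M ≃ₗ[ℤ] K.M × LinearMap.ker π :=
    LinearEquiv.ofLinear (π.prod pr) (i.coprod (LinearMap.ker π).subtype) (by
        apply LinearMap.ext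
        rintro ⟨a, y⟩
        have h3 : π (i a + (y : X.M)) = a := by rw [map_add, h1, hN0, add_zero]
        refine Prod.ext ?_ (Subtype.ext ?_)
        · exact h3
        · change (pr (i a + (y : X.M)) : X.M) = y
          rw [hpr, h3, add_sub_cancel_left]) (by
        apply LinearMap.ext
        intro x
        change i (π x) + (pr x : X.M) = x
        rw [hpr, add_sub_cancel])
  refine ⟨e, ?_, fun x => rfl, fun x => hpr x⟩
  intro x y
  change K.B (π x) (π y) + X.B (pr x : X.M) (pr y : X.M) = X.B x y
  rw [hpr, hpr]
  simp only [map_sub, LinearMap.sub_apply, h2, h1, X.symm x (i _), K.symm (π x)]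
  ring

theorem split_iso (X K : ZLat) (i : K.M →ₗ[ℤ] X.M) (π : X.M →ₗ[ℤ] K.M)
    (h1 : ∀ k, π (i k) = k) (h2 : ∀ k x, X.B (i k) x = K.B k (π x)) :
    Iso X (K.prod (X.sub (LinearMap.ker π))) := by
  obtain ⟨e, he, -⟩ := split_gen X K i π h1 h2
  exact ⟨e, he⟩

theorem split_rank (X K : ZLat) (i : K.M →ₗ[ℤ] X.M) (π : X.M →ₗ[ℤ] K.M)
    (h1 : ∀ k, π (i k) = k) (h2 : ∀ k x, X.B (i k) x = K.B k (π x)) :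
    Module.finrank ℤ X.M = Module.finrank ℤ K.M +
      Module.finrank ℤ (X.sub (LinearMap.ker π)).M := by
  obtain ⟨e, he, -⟩ := split_gen X K i π h1 h2
  rw [e.finrank_eq, Module.finrank_prod]
  rfl

theorem split_uni (X K : ZLat) (i : K.M →ₗ[ℤ] X.M) (π : X.M →ₗ[ℤ] K.M)
    (h1 : ∀ k, π (i k) = k) (h2 : ∀ k x, X.B (i k) x = K.B k (π x)) (hX : X.Uni) :
    (X.sub (LinearMap.ker π)).Uni := by
  obtain ⟨e, he, he1, he2⟩ := split_gen X K i π h1 h2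
  intro f
  obtain ⟨x, hx⟩ := hX (f.comp ((LinearMap.snd ℤ K.M (LinearMap.ker π)).comp e.toLinearMap))
  refine ⟨(e x).2, LinearMap.ext fun (y : LinearMap.ker π) => ?_⟩
  change X.B ((e x).2 : X.M) (y : X.M) = f y
  have hy : π (y : X.M) = 0 := y.2
  have h3 : (e y).2 = y := Subtype.ext (by rw [he2, hy, map_zero, sub_zero])
  have h4 : X.B x y = f (e y).2 := by rw [hx]; rfl
  rw [he2, map_sub, LinearMap.sub_apply, h2, hy, map_zero, sub_zero, h4, h3]

/-- splitting off a vector of norm `±1` -/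
theorem split_one (X : ZLat) (hX : X.Uni) (v : X.M) (hv : X.B v v = 1 ∨ X.B v v = -1) :
    ∃ N : ZLat, N.Uni ∧ Module.finrank ℤ N.M + 1 = Module.finrank ℤ X.M ∧ (SD N → SD X) := by
  set ε := X.B v v with hε
  have hεε : ε * ε = 1 := by rcases hv with h | h <;> rw [h] <;> norm_num
  let i : (Fin 1 → ℤ) →ₗ[ℤ] X.M := (LinearMap.toSpanSingleton ℤ X.M v).comp (LinearMap.proj 0)
  let π : X.M →ₗ[ℤ] (Fin 1 → ℤ) := LinearMap.pi fun _ => ε • X.B v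
  have h1 : ∀ k, π (i k) = k := by
    intro k; ext j
    rw [Subsingleton.elim j 0]
    simp [π, i, ← hε]
    linear_combination (k 0) * hεε
  have h2 : ∀ (k : Fin 1 → ℤ) x, X.B (i k) x = (dg (fun _ : Fin 1 => ε)).B k (π x) := by
    intro k x
    refine Eq.trans ?_ (dg_B _ _ _).symm
    simp [π, i]
    linear_combination (-(k 0) * (X.B v x)) * hεε
  refine ⟨X.sub (LinearMap.ker π), split_uni X (dg (fun _ : Fin 1 => ε)) i π h1 h2 hX, ?_, ?_⟩
  · rw [split_rank X (dg (fun _ : Fin 1 => ε)) i π h1 h2, add_comm]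
    congr 1
    exact (Module.finrank_fin_fun ℤ).symm
  · intro h
    exact SD.iso (split_iso X (dg (fun _ : Fin 1 => ε)) i π h1 h2)
      ((IsD.mk _ (fun _ => hv) (Iso.refl _)).sd.prod h)

theorem isSymm_hs (s : ℤ) : (!![0, 1; 1, s] : Matrix (Fin 2) (Fin 2) ℤ).IsSymm := by
  ext i j; fin_cases i <;> fin_cases j <;> rfl

def hs (s : ℤ) : ZLat := ofMat !![0, 1; 1, s] (isSymm_hs s)

theorem hs_B (s : ℤ) (x y : Fin 2 → ℤ) :
    (hs s).B x y = x 0 * y 1 + x 1 * y 0 + s * x 1 * y 1 := by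
  refine (ofMat_B _ _ _ _).trans ?_
  simp [Matrix.mulVec, dotProduct, Fin.sum_univ_two]
  ring

theorem sd_hs (s : ℤ) : SD (hs s) := by
  rcases Int.even_or_odd' s with ⟨t, rfl | rfl⟩
  · let e : ((Fin 1 → ℤ) × (Fin 2 → ℤ)) ≃ₗ[ℤ] (Fin 3 → ℤ) :=
      { toFun := fun x => ![x.2 0 + x.1 0 + t * x.2 1, x.2 0 + x.1 0 - x.2 1 + t * x.2 1, x.1 0 - x.2 1]
        map_add' := by intro x y; ext i; fin_cases i <;> simp <;> ring
        map_smul' := by intro x y; ext i; fin_cases i <;> simp <;> ring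
        invFun := fun y => (fun _ => y 0 - y 1 + y 2, ![- t * y 0 + (1 + t) * y 1 - y 2, y 0 - y 1])
        left_inv := by
          intro x; ext i
          · fin_cases i; simp
          · fin_cases i <;> simp ; ring
        right_inv := by intro x; ext i; fin_cases i <;> simp <;> ring }
    have key : ∀ x y : (Fin 1 → ℤ) × (Fin 2 → ℤ), ∑ i, (![1, -1, 1] : Fin 3 → ℤ) i * e x i * e y i =
        ∑ i : Fin 1, 1 * x.1 i * y.1 i +
          (x.2 0 * y.2 1 + x.2 1 * y.2 0 + (2 * t) * x.2 1 * y.2 1) := by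
      intro x y
      simp [Fin.sum_univ_succ, e]
      ring
    refine ⟨dg (fun _ : Fin 1 => 1), IsD.mk _ (fun _ => Or.inl rfl) (Iso.refl _),
      IsD.mk (ι := Fin 3) ![1, -1, 1] (by intro i; fin_cases i <;> simp) ⟨e, fun x y =>
        (dg_B _ _ _).trans ((key x y).trans
          (congrArg₂ (· + ·) (dg_B (fun _ : Fin 1 => 1) x.1 y.1) (hs_B (2 * t) x.2 y.2)).symm)⟩⟩
  · let e : (Fin 2 → ℤ) ≃ₗ[ℤ] (Fin 2 → ℤ) :=
      { toFun := fun x => ![x 0 + x 1 + t * x 1, x 0 + t * x 1]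
        map_add' := by intro x y; ext i; fin_cases i <;> simp <;> ring
        map_smul' := by intro x y; ext i; fin_cases i <;> simp <;> ring
        invFun := fun y => ![y 1 - t * (y 0 - y 1), y 0 - y 1]
        left_inv := by intro x; ext i; fin_cases i <;> simp 
        right_inv := by intro x; ext i; fin_cases i <;> simp }
    have key : ∀ x y : (Fin 2 → ℤ), ∑ i, (![1, -1] : Fin 2 → ℤ) i * e x i * e y i =
          (x 0 * y 1 + x 1 * y 0 + (2 * t + 1) * x 1 * y 1) := by
      intro x y
      simp [Fin.sum_univ_succ, e]
      ring
    exact IsD.sd (IsD.mk (ι := Fin 2) ![1, -1] (by intro i; fin_cases i <;> simp) ⟨e, fun x y => 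
      (dg_B _ _ _).trans ((key x y).trans (hs_B (2 * t + 1) x y).symm)⟩)


/-- splitting off a hyperbolic-type plane -/
theorem split_hyp (X : ZLat) (hX : X.Uni) (u w : X.M) (hu : X.B u u = 0) (huw : X.B u w = 1) :
    ∃ N : Submodule ℤ X.M, (∀ x, X.B u x = 0 → X.B w x = 0 → x ∈ N) ∧ (X.sub N).Uni ∧
      Module.finrank ℤ (X.sub N).M + 2 = Module.finrank ℤ X.M ∧ (SD (X.sub N) → SD X) := by
  set s := X.B w w with hs'
  have hwu : X.B w u = 1 := by rw [X.symm, huw]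
  let i : (Fin 2 → ℤ) →ₗ[ℤ] X.M := (LinearMap.toSpanSingleton ℤ X.M u).comp (LinearMap.proj 0) +
    (LinearMap.toSpanSingleton ℤ X.M w).comp (LinearMap.proj 1)
  let π : X.M →ₗ[ℤ] (Fin 2 → ℤ) := LinearMap.pi ![X.B w - s • X.B u, X.B u]
  have h1 : ∀ k, π (i k) = k := by
    intro k; ext j
    fin_cases j <;> simp [π, i, ← hs', hu, huw, hwu] <;> ring
  have h2 : ∀ (k : Fin 2 → ℤ) x, X.B (i k) x = (hs s).B k (π x) := by
    intro k x
    refine Eq.trans ?_ (hs_B _ _ _).symm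
    simp [π, i]
    ring
  refine ⟨LinearMap.ker π, ?_, split_uni X (hs s) i π h1 h2 hX, ?_, ?_⟩
  · intro x hx hx'
    rw [LinearMap.mem_ker]
    ext j
    fin_cases j <;> simp [π, hx, hx']
  · rw [split_rank X (hs s) i π h1 h2, add_comm]
    congr 1
    exact (Module.finrank_fin_fun ℤ).symm
  · intro h
    exact SD.iso (split_iso X (hs s) i π h1 h2) ((sd_hs s).prod h)

theorem iso_red (k : ℕ) : ∀ (X : ZLat), X.Uni → ∀ (u : Fin k → X.M), LinearIndependent ℤ u →
    (∀ i j, X.B (u i) (u j) = 0) →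
    (∀ Y : ZLat, Y.Uni → Module.finrank ℤ Y.M + 2 * k = Module.finrank ℤ X.M → SD Y) → SD X := by
  induction k with
  | zero => intro X hX u _ _ h; exact h X hX (by simp)
  | succ k ih =>
    intro X hX u hu hiso h
    obtain ⟨d, u0, f, hd, hdu, hf⟩ := exists_prim (u 0) (hu.ne_zero 0)
    obtain ⟨w, hw⟩ := hX f
    have huw : X.B u0 w = 1 := by rw [X.symm, hw, hf]
    have hu0 : ∀ j, X.B u0 (u j) = 0 := by
      intro j
      have := hiso 0 j
      rw [hdu, map_smul, LinearMap.smul_apply, smul_eq_mul] at this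
      exact (mul_eq_zero.mp this).resolve_left hd
    have hu00 : X.B u0 u0 = 0 := by
      have := hu0 0
      rw [hdu, map_smul, smul_eq_mul] at this
      exact (mul_eq_zero.mp this).resolve_left hd
    obtain ⟨N, hN, hNu, hNr, hNS⟩ := split_hyp X hX u0 w hu00 huw
    apply hNS
    have hmem : ∀ j : Fin k, u j.succ - X.B w (u j.succ) • u0 ∈ N := by
      intro j
      apply hN
      · simp [hu0, hu00]
      · simp [X.symm w u0, huw]
    refine ih (X.sub N) hNu (fun j => (⟨_, hmem j⟩ : N)) ?_ ?_ ?_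
    · apply LinearIndependent.of_comp N.subtype
      rw [Fintype.linearIndependent_iff] at hu ⊢
      intro g hg i
      have hg' : ∑ j, g j • (u j.succ - X.B w (u j.succ) • u0) = 0 := hg
      have := hu (Fin.cons (-∑ j, g j * X.B w (u j.succ)) (fun j => d * g j)) (by
        rw [Fin.sum_univ_succ]
        simp only [Fin.cons_zero, Fin.cons_succ]
        conv_lhs => enter [1]; rw [hdu]
        have h3 := congrArg (fun z => d • z) hg'
        simp only [smul_zero] at h3
        rw [← h3]
        rw [Finset.smul_sum, neg_smul, Finset.sum_smul, ← Finset.sum_neg_distrib,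
          ← Finset.sum_add_distrib]
        exact Finset.sum_congr rfl fun j _ => by module) i.succ
      simp only [Fin.cons_succ] at this
      exact (mul_eq_zero.mp this).resolve_left hd
    · intro i j
      change X.B (u i.succ - X.B w (u i.succ) • u0) (u j.succ - X.B w (u j.succ) • u0) = 0
      simp [hiso, hu0, hu00, X.symm _ u0]
    · intro Y hY hr
      exact h Y hY (by omega)

end ZLat

namespace ZLat

theorem det_chio (n : ℕ) (G : Matrix (Fin (n+2)) (Fin (n+2)) ℤ) (h0 : G 0 0 ≠ 0) :
    (G 0 0)^n * G.det =
      (Matrix.of fun i j : Fin (n+1) => G 0 0 * G i.succ j.succ - G i.succ 0 * G 0 j.succ).det := by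
  set a := G 0 0 with ha
  let c : Fin (n+2) → ℤ := Fin.cons 1 fun _ => a
  let G' : Matrix (Fin (n+2)) (Fin (n+2)) ℤ := Matrix.of fun i j => c i * G i j
  have h1 : G'.det = a^(n+1) * G.det := by
    rw [Matrix.det_mul_column]
    congr 1
    rw [Fin.prod_univ_succ]
    simp [c]
  let k : Fin (n+2) → ℤ := Fin.cons 0 fun i => - G i.succ 0
  let G'' : Matrix (Fin (n+2)) (Fin (n+2)) ℤ := Matrix.of fun i j => G' i j + k i * G' 0 j
  have h2 : G''.det = G'.det :=
    Matrix.det_eq_of_forall_row_eq_smul_add_const k 0 (by simp [k]) (fun i j => rfl)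
  have h3 : G''.det = a * (Matrix.of fun i j : Fin (n+1) =>
      a * G i.succ j.succ - G i.succ 0 * G 0 j.succ).det := by
    rw [Matrix.det_succ_column_zero, Fin.sum_univ_succ, Finset.sum_eq_zero]
    · have : G'' 0 0 = a := by simp [G'', G', k, c, ha]
      rw [this]
      simp only [Fin.val_zero, pow_zero, one_mul, add_zero]
      congr 2
      ext i j
      simp [G'', G', k, c, ha]
      ring
    · intro i _
      have : G'' i.succ 0 = 0 := by simp [G'', G', k, c, ha]; ring
      rw [this]; simp
  apply mul_left_cancel₀ h0
  rw [← h3, h2, h1]; ring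

def herC (n : ℕ) : ℚ := ∏ i ∈ Finset.range n, (4/3 : ℚ)^(i+1)

def red (L : ZLat) (v : L.M) (N : Submodule ℤ L.M) : ZLat where
  M := N
  B := (L.B v v • L.B - (L.B.flip v).smulRight (L.B v)).compl₁₂ N.subtype N.subtype
  symm x y := by
    simp [L.symm x.1 y.1, L.symm x.1 v, L.symm y.1 v]; ring

theorem red_B (L : ZLat) (v : L.M) (N : Submodule ℤ L.M) (x y : N) :
    (L.red v N).B x y = L.B v v * L.B x y - L.B x v * L.B v y := rfl

theorem gram_det (L : ZLat) {n : ℕ} (b c : Module.Basis (Fin n) ℤ L.M) :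
    |(Matrix.of fun i j => L.B (b i) (b j)).det| = |(Matrix.of fun i j => L.B (c i) (c j)).det| := by
  have h := LinearMap.BilinForm.toMatrix_mul_basis_toMatrix b c (L.B : LinearMap.BilinForm ℤ L.M)
  have hb : (Matrix.of fun i j => L.B (b i) (b j)) = LinearMap.BilinForm.toMatrix b L.B := by
    ext i j; simp [LinearMap.BilinForm.toMatrix_apply]
  have hc : (Matrix.of fun i j => L.B (c i) (c j)) = LinearMap.BilinForm.toMatrix c L.B := by
    ext i j; simp [LinearMap.BilinForm.toMatrix_apply]
  rw [hb, hc, ← h, Matrix.det_mul, Matrix.det_mul, Matrix.det_transpose, abs_mul, abs_mul]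
  have hu : IsUnit (b.toMatrix c).det := by
    have := congrArg Matrix.det (b.toMatrix_mul_toMatrix_flip c)
    rw [Matrix.det_mul, Matrix.det_one] at this
    exact IsUnit.of_mul_eq_one _ this
  have : |(b.toMatrix c).det| = 1 := Int.isUnit_iff_abs_eq.mp hu
  rw [this]; ring

theorem hermite (n : ℕ) : ∀ (L : ZLat) (b : Module.Basis (Fin (n+1)) ℤ L.M),
    (∀ x, L.B x x = 0 → x = 0) → ∃ v : L.M, v ≠ 0 ∧
      ((|L.B v v| : ℤ) : ℚ)^(n+1) ≤ herC n *
        ((|(Matrix.of fun i j => L.B (b i) (b j)).det| : ℤ) : ℚ) := by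
  induction n with
  | zero =>
    intro L b h
    refine ⟨b 0, b.ne_zero 0, ?_⟩
    simp [herC]
  | succ n ih =>
    intro L b h
    have hmin : ∃ v : L.M, v ≠ 0 ∧ ∀ w : L.M, w ≠ 0 → |L.B v v| ≤ |L.B w w| := by
      classical
      have hex : ∃ k : ℕ, ∃ v : L.M, v ≠ 0 ∧ (L.B v v).natAbs = k := ⟨_, b 0, b.ne_zero 0, rfl⟩
      obtain ⟨v, hv, hk⟩ := Nat.find_spec hex
      refine ⟨v, hv, fun w hw => ?_⟩
      have := Nat.find_min' hex ⟨w, hw, rfl⟩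
      rw [← hk] at this
      rw [Int.abs_eq_natAbs, Int.abs_eq_natAbs]
      exact_mod_cast this
    obtain ⟨v₀, hv₀, hm₀⟩ := hmin
    obtain ⟨d, v, f, hd, hdv, hf⟩ := exists_prim v₀ hv₀
    have hv : v ≠ 0 := by rintro rfl; simp at hf
    have hm : ∀ w : L.M, w ≠ 0 → |L.B v v| ≤ |L.B w w| := by
      intro w hw
      refine le_trans ?_ (hm₀ w hw)
      rw [hdv]
      simp only [map_smul, LinearMap.smul_apply, smul_eq_mul, abs_mul]
      have : 1 ≤ |d| := Int.one_le_abs hd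
      nlinarith [abs_nonneg (L.B v v), mul_nonneg (sub_nonneg.mpr this) (abs_nonneg (L.B v v))]
    set a := L.B v v with ha
    have ha0 : a ≠ 0 := fun h0 => hv (h v h0)
    let N := LinearMap.ker f
    have hfin : Module.finrank ℤ N = n + 1 := by
      have hsurj : Function.Surjective f := fun z => ⟨z • v, by simp [hf]⟩
      have h1 := Submodule.finrank_quotient_add_finrank (LinearMap.ker f)
      rw [(f.quotKerEquivOfSurjective hsurj).finrank_eq, Module.finrank_self,
        Module.finrank_eq_card_basis b, Fintype.card_fin] at h1
      change 1 + Module.finrank ℤ N = _ at h1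
      omega
    let b' : Module.Basis (Fin (n+1)) ℤ N := Module.finBasisOfFinrankEq ℤ N hfin
    let e : Module.Basis (Fin (n+2)) ℤ L.M := Module.Basis.mkFinCons v b'
      (by
        intro c x hx hc
        have := congrArg f hc
        have hx' : f x = 0 := hx
        simpa [hf, hx'] using this)
      (by
        intro z
        refine ⟨- f z, ?_⟩
        rw [LinearMap.mem_ker]; simp [hf])
    have he0 : e 0 = v := by simp [e]
    have hes : ∀ i : Fin (n+1), e i.succ = b' i := by intro i; simp [e]
    have hdet := det_chio n (Matrix.of fun i j => L.B (e i) (e j)) (by simpa [he0] using ha0)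
    obtain ⟨⟨w, hwN⟩, hw0, hw⟩ := ih (L.red v N) b' (by
      intro (x : N) hx
      rw [red_B] at hx
      have hz := h (a • (x : L.M) - L.B x v • v) (by
        simp only [map_sub, map_smul, LinearMap.sub_apply, LinearMap.smul_apply, smul_eq_mul,
          L.symm v x, ← ha] at hx ⊢
        linear_combination a * hx)
      have hx' : f x = 0 := x.2
      have h4 := congrArg f hz
      simp only [map_sub, map_smul, hx', hf, smul_eq_mul, map_zero] at h4
      have h5 : L.B x v = 0 := by linarith
      rw [h5, zero_smul, sub_zero] at hz
      exact Subtype.ext ((smul_eq_zero.mp hz).resolve_left ha0))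
    refine ⟨v, hv, ?_⟩
    rw [gram_det L b e]
    set G := Matrix.of fun i j => L.B (e i) (e j) with hG
    have hH : (Matrix.of fun i j => (L.red v N).B (b' i) (b' j)).det = a^n * G.det := by
      have h00 : G 0 0 = a := by simp [hG, he0, ha]
      rw [h00] at hdet
      rw [hdet]
      congr 1
      ext i j
      refine (red_B _ _ _ _ _).trans ?_
      simp [hG, he0, hes, ← ha]
    have hw2 : ((|a * L.B w w - L.B w v * L.B v w| : ℤ) : ℚ)^(n+1) ≤
        herC n * ((|a^n * G.det| : ℤ) : ℚ) := by
      rw [← hH]; exact hw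
    clear hw
    rename' hw2 => hw
    have hfw : f w = 0 := hwN
    have hw0' : w ≠ 0 := fun h0 => hw0 (Subtype.ext h0)
    simp only [← ha] at hw ⊢
    set s := L.B w v with hs
    have hsv : L.B v w = s := L.symm _ _
    rw [hsv] at hw
    let t : ℤ := round ((s : ℚ) / a)
    have ht : |(s : ℚ) / a - t| ≤ 1 / 2 := abs_sub_round _
    have haq : (a : ℚ) ≠ 0 := by exact_mod_cast ha0
    have ht2 : ((s : ℚ) - t * a)^2 ≤ (a : ℚ)^2 / 4 := by
      have h6 : (s : ℚ) - t * a = a * ((s : ℚ) / a - t) := by field_simp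
      rw [h6, mul_pow]
      have h7 : ((s : ℚ) / a - t)^2 ≤ (1/2)^2 := by
        rw [sq_le_sq]; rw [abs_of_nonneg (by norm_num : (0:ℚ) ≤ 1/2)]; exact ht
      nlinarith [sq_nonneg (a : ℚ)]
    have hw' := hm (w - t • v) (by
      intro h0
      have h8 := congrArg f h0
      simp only [map_sub, map_smul, hfw, hf, smul_eq_mul, map_zero] at h8
      have h9 : t = 0 := by linarith
      rw [h9, zero_smul, sub_zero] at h0
      exact hw0' h0)
    have hBw : a * L.B (w - t • v) (w - t • v) = (a * L.B w w - s * s) + (s - t * a)^2 := by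
      simp only [map_sub, map_smul, LinearMap.sub_apply, LinearMap.smul_apply, smul_eq_mul, ← ha, ← hs, hsv]
      ring
    set β := a * L.B w w - s * s with hβ
    have key : (a : ℚ)^2 ≤ 4/3 * ((|β| : ℤ) : ℚ) := by
      have h10 : a^2 ≤ |β| + (s - t * a)^2 := by
        calc a^2 = |a| * |a| := by rw [← sq, sq_abs]
          _ ≤ |a| * |L.B (w - t • v) (w - t • v)| := mul_le_mul_of_nonneg_left hw' (abs_nonneg _)
          _ = |β + (s - t * a)^2| := by rw [← abs_mul, hBw]
          _ ≤ |β| + |(s - t * a)^2| := abs_add_le _ _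
          _ = _ := by rw [abs_of_nonneg (sq_nonneg (s - t * a))]
      have h11 : (a : ℚ)^2 ≤ ((|β| : ℤ) : ℚ) + ((s : ℚ) - t * a)^2 := by exact_mod_cast h10
      linarith
    have hA : (0 : ℚ) < ((|a| : ℤ) : ℚ) := by exact_mod_cast abs_pos.mpr ha0
    have hsq : (a : ℚ)^2 = (((|a| : ℤ) : ℚ))^2 := by
      push_cast; rw [sq_abs]
    rw [hsq] at key
    rw [abs_mul, abs_pow] at hw
    generalize G.det = g at hw ⊢
    push_cast at hw key hA ⊢
    have hC : herC (n+1) = herC n * (4/3)^(n+1) := by simp [herC, Finset.prod_range_succ]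
    rw [hC]
    have h12 := pow_le_pow_left₀ (by positivity) key (n+1)
    rw [mul_pow] at h12
    have h13 : (0:ℚ) < |(a:ℚ)|^n := by positivity
    refine le_of_mul_le_mul_left ?_ h13
    calc |(a:ℚ)|^n * |(a:ℚ)|^(n+1+1) = (|(a:ℚ)|^2)^(n+1) := by ring
      _ ≤ (4/3)^(n+1) * |(β:ℚ)|^(n+1) := h12
      _ ≤ (4/3)^(n+1) * (herC n * (|(a:ℚ)|^n * |(g : ℚ)|)) := by gcongr
      _ = _ := by ring

theorem uni_det (L : ZLat) (hL : L.Uni) {n : ℕ} (b : Module.Basis (Fin n) ℤ L.M) :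
    |(Matrix.of fun i j => L.B (b i) (b j)).det| = 1 := by
  choose x hx using fun i => hL (b.coord i)
  have : (Matrix.of fun i k => b.repr (x i) k) * (Matrix.of fun i j => L.B (b i) (b j)) = 1 := by
    ext i j
    rw [Matrix.mul_apply]
    have h1 : L.B (x i) (b j) = b.coord i (b j) := by rw [hx]
    conv_lhs at h1 => rw [← b.sum_repr (x i)]
    simp only [map_sum, map_smul, LinearMap.sum_apply, LinearMap.smul_apply, smul_eq_mul] at h1
    simp only [Matrix.of_apply]
    rw [h1, Module.Basis.coord_apply, b.repr_self, Finsupp.single_apply, Matrix.one_apply]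
    simp [eq_comm]
  have h2 := congrArg Matrix.det this
  rw [Matrix.det_mul, Matrix.det_one, mul_comm] at h2
  exact Int.isUnit_iff_abs_eq.mp (IsUnit.of_mul_eq_one _ h2)

theorem small_norm (L : ZLat) (hL : L.Uni) (h1 : 1 ≤ Module.finrank ℤ L.M)
    (h5 : Module.finrank ℤ L.M ≤ 5) (ha : ∀ x, L.B x x = 0 → x = 0) :
    ∃ v : L.M, L.B v v = 1 ∨ L.B v v = -1 := by
  obtain ⟨n, hn⟩ : ∃ n, Module.finrank ℤ L.M = n + 1 := ⟨_, (Nat.sub_add_cancel h1).symm⟩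
  obtain ⟨v, hv, hle⟩ := hermite n L (Module.finBasisOfFinrankEq ℤ L.M hn) ha
  rw [uni_det L hL] at hle
  refine ⟨v, ?_⟩
  have hv0 : L.B v v ≠ 0 := fun h => hv (ha v h)
  have hb : |L.B v v| < 2 := by
    by_contra hcon
    push Not at hcon
    have h2 : (2 : ℚ) ≤ ((|L.B v v| : ℤ) : ℚ) := by exact_mod_cast hcon
    have h3 := pow_le_pow_left₀ (by norm_num) h2 (n+1)
    have h4 := h3.trans hle
    have hn4 : n ≤ 4 := by omega
    interval_cases n <;> norm_num [herC, Finset.prod_range_succ] at h4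
  have := abs_lt.mp hb
  omega

end ZLat

namespace ZLat

theorem arith_sq (q : ℕ) (hq : q.Prime) (h3 : q % 4 = 3) (K : ℤ) (hK : IsCoprime K q) :
    ∃ (b δ : ℤ), (δ = 1 ∨ δ = -1) ∧ (q : ℤ) ∣ b^2 * K - δ := by
  haveI : Fact q.Prime := ⟨hq⟩
  have hK0 : (K : ZMod q) ≠ 0 := by
    intro h
    rw [ZMod.intCast_zmod_eq_zero_iff_dvd] at h
    have h1 : IsUnit (q : ℤ) := hK.isUnit_of_dvd' h dvd_rfl
    have := Int.isUnit_iff.mp h1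
    have := hq.two_le
    omega
  have hn1 : ¬ IsSquare (-1 : ZMod q) := by
    rw [ZMod.exists_sq_eq_neg_one_iff]; simpa using h3
  have hc2 : ringChar (ZMod q) ≠ 2 := by
    rw [ZMod.ringChar_zmod_n]; omega
  have key : ∃ δ : ℤ, (δ = 1 ∨ δ = -1) ∧ IsSquare ((δ : ZMod q) * K) := by
    rcases quadraticChar_dichotomy hK0 with h | h
    · exact ⟨1, Or.inl rfl, by simpa using (quadraticChar_one_iff_isSquare hK0).mp h⟩
    · refine ⟨-1, Or.inr rfl, ?_⟩
      have hne : (((-1 : ℤ) : ZMod q) * K) ≠ 0 := by simpa using hK0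
      rw [← quadraticChar_one_iff_isSquare hne, map_mul, h]
      have : quadraticChar (ZMod q) (-1) = -1 := quadraticChar_neg_one_iff_not_isSquare.mpr hn1
      simp [this]
  obtain ⟨δ, hδ, c, hc⟩ := key
  have hδδ : (δ : ZMod q) * δ = 1 := by rcases hδ with h | h <;> simp [h]
  have hc0 : c ≠ 0 := by
    rintro rfl
    apply hK0
    calc (K : ZMod q) = δ * δ * K := by rw [hδδ, one_mul]
      _ = δ * (δ * K) := by ring
      _ = 0 := by rw [hc]; simp
  obtain ⟨b, hb⟩ := ZMod.intCast_surjective (c⁻¹)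
  refine ⟨b, δ, hδ, ?_⟩
  rw [← ZMod.intCast_zmod_eq_zero_iff_dvd]
  push_cast
  rw [hb]
  have : (K : ZMod q) = δ * (c * c) := by rw [← hc, ← mul_assoc, hδδ, one_mul]
  rw [this]
  field_simp
  ring

theorem arith (K2 K3 : ℤ) (hco : IsCoprime K2 K3) (hK3 : K3 ≠ 0) :
    ∃ a4 a5 b : ℤ, a5 * (a4 * K3 - K2) - b^2 * K3 = 1 ∨ a5 * (a4 * K3 - K2) - b^2 * K3 = -1 := by
  obtain ⟨c, hc⟩ : ∃ c : ℤ, Odd (c * K3 - K2) := by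
    rcases Int.even_or_odd K2 with h | h
    · refine ⟨1, ?_⟩
      have : Odd K3 := by
        by_contra h3
        rw [Int.not_odd_iff_even] at h3
        have := hco.isUnit_of_dvd' h.two_dvd h3.two_dvd
        exact absurd (Int.isUnit_iff.mp this) (by norm_num)
      rw [one_mul]; exact this.sub_even h
    · exact ⟨0, by simpa using h⟩
  set t := c * K3 - K2 with ht
  have htK : IsCoprime t K3 := by
    have := (hco.neg_left).add_mul_right_left c
    rwa [show -K2 + c * K3 = t by rw [ht]; ring] at this
  have ht4 : IsCoprime t 4 := by
    have h2 : IsCoprime t 2 := by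
      obtain ⟨k, hk⟩ := hc
      exact ⟨1, -k, by rw [hk]; ring⟩
    simpa using (h2.mul_right h2)
  have ht4K : IsCoprime t (4 * K3) := ht4.mul_right htK
  obtain ⟨σ, hσ, hσ3⟩ : ∃ σ : ℤ, (σ = 1 ∨ σ = -1) ∧ (σ * t) % 4 = 3 := by
    obtain ⟨k, hk⟩ := hc
    rcases Int.even_or_odd' k with ⟨l, rfl | rfl⟩
    · exact ⟨-1, Or.inr rfl, by omega⟩
    · exact ⟨1, Or.inl rfl, by omega⟩
  have hσσ : σ * σ = 1 := by rcases hσ with h | h <;> rw [h] <;> norm_num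
  have hσt : IsCoprime (σ * t) (4 * K3) := by
    rcases hσ with h | h <;> rw [h]
    · simpa using ht4K
    · simpa using ht4K.neg_left
  have hcast : ((4 * K3).natAbs : ℤ) ∣ 4 * K3 := Int.natAbs_dvd.mpr dvd_rfl
  obtain ⟨q, -, hq, hqm⟩ := Nat.forall_exists_prime_gt_and_zmodEq 0 (q := (4 * K3).natAbs)
    (a := σ * t) (by simpa using hK3) (by
      obtain ⟨k, hk⟩ := hcast
      rcases Int.natAbs_eq (4 * K3) with h | h
      · rw [← h]; exact hσt
      · have h' : ((4 * K3).natAbs : ℤ) = -(4 * K3) := by omega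
        rw [h']; exact hσt.neg_right)
  have hd : (4 * K3) ∣ (q : ℤ) - σ * t :=
    (Int.dvd_natAbs.mpr dvd_rfl).trans hqm.symm.dvd
  obtain ⟨j, hj⟩ := hd
  have hqe : (q : ℤ) = σ * t + 4 * (K3 * j) := by linarith
  have hq4 : q % 4 = 3 := by omega
  have hqK : IsCoprime K3 (q : ℤ) := by
    have h1 : IsCoprime (σ * t) K3 := hσt.of_mul_right_right
    have h2 := h1.add_mul_right_left (4 * j)
    rw [show σ * t + 4 * j * K3 = q by rw [hqe]; ring] at h2
    exact h2.symm
  obtain ⟨b, δ, hδ, a, ha⟩ := arith_sq q hq hq4 K3 hqK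
  refine ⟨c + 4 * σ * j, σ * a, b, ?_⟩
  have h4 : (c + 4 * σ * j) * K3 - K2 = σ * q := by
    rw [hqe, mul_add, ← mul_assoc σ σ t, hσσ, ht]; ring
  have h5 : σ * a * ((c + 4 * σ * j) * K3 - K2) - b^2 * K3 = - δ := by
    rw [h4, show σ * a * (σ * q) = σ * σ * (q * a) by ring, hσσ, ← ha]; ring
  rw [h5]
  rcases hδ with h | h <;> simp [h]

theorem ofMat_uni {ι : Type} [Fintype ι] [DecidableEq ι] (A : Matrix ι ι ℤ) (h : A.IsSymm)
    (hd : IsUnit A.det) : (ofMat A h).Uni := by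
  intro f
  let g : ι → ℤ := fun i => f (Pi.single i 1)
  refine ⟨g ᵥ* A⁻¹, ?_⟩
  refine LinearMap.ext fun (y : ι → ℤ) => ?_
  refine (ofMat_B _ _ _ _).trans ?_
  rw [Matrix.dotProduct_mulVec, Matrix.vecMul_vecMul, Matrix.nonsing_inv_mul _ hd, Matrix.vecMul_one]
  have : y = ∑ i, y i • (Pi.single i (1 : ℤ) : ι → ℤ) := by
    ext j; simp [Finset.sum_apply, Pi.single_apply]
  have h2 : f y = ∑ i, y i • g i := by
    conv_lhs => rw [this]
    refine (map_sum f _ _).trans ?_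
    exact Finset.sum_congr rfl fun i _ => map_smul f _ _
  rw [h2]
  simp [dotProduct, mul_comm]

theorem prod_uni {L K : ZLat} (hL : L.Uni) (hK : K.Uni) : (L.prod K).Uni := by
  intro (f : L.M × K.M →ₗ[ℤ] ℤ)
  obtain ⟨x, hx⟩ := hL (f.comp (LinearMap.inl ℤ _ _))
  obtain ⟨y, hy⟩ := hK (f.comp (LinearMap.inr ℤ _ _))
  refine ⟨(x, y), LinearMap.ext fun (z : L.M × K.M) => ?_⟩
  change L.B x z.1 + K.B y z.2 = f z
  rw [hx, hy]
  simp [← map_add]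

theorem neg_uni {L : ZLat} (hL : L.Uni) : L.neg.Uni := by
  intro (f : L.M →ₗ[ℤ] ℤ)
  obtain ⟨x, hx⟩ := hL (-f)
  refine ⟨x, LinearMap.ext fun (z : L.M) => ?_⟩
  change - L.B x z = f z
  rw [hx]; simp

def tri (a1 a2 a3 a4 a5 b : ℤ) : Matrix (Fin 5) (Fin 5) ℤ :=
  !![a1, 1, 0, 0, 0; 1, a2, 1, 0, 0; 0, 1, a3, 1, 0; 0, 0, 1, a4, b; 0, 0, 0, b, a5]

theorem tri_symm (a1 a2 a3 a4 a5 b : ℤ) : (tri a1 a2 a3 a4 a5 b).IsSymm := by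
  ext i j; fin_cases i <;> fin_cases j <;> rfl

theorem tri_det (a1 a2 a3 a4 a5 b : ℤ) : (tri a1 a2 a3 a4 a5 b).det =
    a5 * (a4 * (a3 * (a1 * a2 - 1) - a1) - (a1 * a2 - 1)) - b^2 * (a3 * (a1 * a2 - 1) - a1) := by
  simp [tri, Matrix.det_succ_row_zero, Fin.sum_univ_succ, Fin.succAbove]
  ring

theorem step (X : ZLat) (hX : X.Uni) (r : ℕ) (hr : Module.finrank ℤ X.M = r) (h6 : 6 ≤ r)
    (ih : ∀ Y : ZLat, Y.Uni → Module.finrank ℤ Y.M < r → SD Y) (v : Fin 3 → X.M)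
    (h01 : X.B (v 0) (v 1) = 1) (h12 : X.B (v 1) (v 2) = 1) (h02 : X.B (v 0) (v 2) = 0)
    (hK : X.B (v 2) (v 2) * (X.B (v 0) (v 0) * X.B (v 1) (v 1) - 1) - X.B (v 0) (v 0) ≠ 0) :
    SD X := by
  set a1 := X.B (v 0) (v 0) with h1
  set a2 := X.B (v 1) (v 1) with h2
  set a3 := X.B (v 2) (v 2) with h3
  obtain ⟨a4, a5, b, hab⟩ := arith (a1 * a2 - 1) (a3 * (a1 * a2 - 1) - a1)
    ⟨a2 * a3 - 1, -a2, by ring⟩ hK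
  let T := tri a1 a2 a3 a4 a5 b
  let E : ZLat := ofMat T (tri_symm a1 a2 a3 a4 a5 b)
  have hE : E.Uni := ofMat_uni _ _ (by
    rw [tri_det, Int.isUnit_iff]; exact hab)
  have hEr : Module.finrank ℤ E.M = 5 := by
    change Module.finrank ℤ (Fin 5 → ℤ) = 5
    simp
  have hsdE : SD E := ih E hE (by omega)
  have hV : (X.prod E.neg).Uni := prod_uni hX (neg_uni hE)
  refine SD.of_prod (K := E.neg) ?_ hsdE.neg
  let ee : Fin 3 → (Fin 5 → ℤ) := fun i => Pi.single (Fin.castLE (by norm_num) i) 1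
  let u : Fin 3 → X.M × (Fin 5 → ℤ) := fun i => (v i, ee i)
  have hu : LinearIndependent ℤ u := by
    have : LinearIndependent ℤ (fun i => (LinearMap.snd ℤ X.M (Fin 5 → ℤ)) (u i)) := by
      change LinearIndependent ℤ ee
      have h := (Pi.basisFun ℤ (Fin 5)).linearIndependent.comp
        (Fin.castLE (by norm_num) : Fin 3 → Fin 5) (Fin.castLE_injective _)
      convert h using 1
      · ext i j
        simp [ee]
      · exact Subsingleton.elim _ _
    exact LinearIndependent.of_comp (LinearMap.snd ℤ X.M (Fin 5 → ℤ)) this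
  refine iso_red 3 (X.prod E.neg) hV u hu ?_ ?_
  · intro i j
    have hT : E.B (ee i) (ee j) = T (Fin.castLE (by norm_num) i) (Fin.castLE (by norm_num) j) := by
      refine (ofMat_B _ _ _ _).trans ?_
      simp [ee]
    change X.B (v i) (v j) + - E.B (ee i) (ee j) = 0
    rw [hT]
    have h10 := X.symm (v 1) (v 0)
    have h21 := X.symm (v 2) (v 1)
    have h20 := X.symm (v 2) (v 0)
    fin_cases i <;> fin_cases j <;>
      simp [T, tri, h01, h12, h02, h10, h20, h21, ← h1, ← h2, ← h3]
  · intro Y hY hYr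
    have hrk : Module.finrank ℤ (X.prod E.neg).M = r + 5 := by
      change Module.finrank ℤ (X.M × E.M) = _
      rw [Module.finrank_prod, hr, hEr]
    exact ih Y hY (by omega)

theorem vecs (X : ZLat) (hX : X.Uni) (h6 : 3 ≤ Module.finrank ℤ X.M)
    (hani : ∀ x, X.B x x = 0 → x = 0) (hno : ∀ x, ¬ (X.B x x = 1 ∨ X.B x x = -1)) :
    ∃ v : Fin 3 → X.M, X.B (v 0) (v 1) = 1 ∧ X.B (v 1) (v 2) = 1 ∧ X.B (v 0) (v 2) = 0 ∧
      X.B (v 2) (v 2) * (X.B (v 0) (v 0) * X.B (v 1) (v 1) - 1) - X.B (v 0) (v 0) ≠ 0 := by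
  obtain ⟨n, hn⟩ : ∃ n, Module.finrank ℤ X.M = n + 3 := ⟨_, (Nat.sub_add_cancel h6).symm⟩
  let b := Module.finBasisOfFinrankEq ℤ X.M hn
  have i01 : (0 : Fin (n+3)) ≠ 1 := by simp [Fin.ext_iff]
  have i02 : (0 : Fin (n+3)) ≠ 2 := by
    intro h; have := congrArg Fin.val h; simp at this; rw [Nat.mod_eq_of_lt (by omega)] at this; omega
  have i12 : (1 : Fin (n+3)) ≠ 2 := by
    intro h; have := congrArg Fin.val h; simp at this; rw [Nat.mod_eq_of_lt (by omega)] at this; omega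
  obtain ⟨x1, x2, hx, hco⟩ : ∃ x1 x2 : ℤ, X.B (b 0) (b 1) * x1 + X.B (b 0) (b 2) * x2 = 0 ∧
      IsCoprime x1 x2 := by
    generalize X.B (b 0) (b 1) = c1
    generalize X.B (b 0) (b 2) = c2
    by_cases h : c1 = 0 ∧ c2 = 0
    · exact ⟨1, 0, by rw [h.1, h.2]; ring, isCoprime_one_left⟩
    · have hg : 0 < Int.gcd c1 c2 := Int.gcd_pos_iff.mpr (by tauto)
      obtain ⟨u, w, huw, hc1, hc2⟩ := Int.exists_gcd_one hg
      refine ⟨w, -u, by linear_combination w * hc1 - u * hc2, ?_⟩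
      exact (Int.isCoprime_iff_gcd_eq_one.mpr huw).symm.neg_right
  obtain ⟨s1, s2, hs⟩ := hco
  obtain ⟨v2, hv2⟩ := hX (b.coord 0 + s1 • b.coord 1 + s2 • b.coord 2)
  have hy : ∀ z, X.B v2 z = b.coord 0 z + s1 * b.coord 1 z + s2 * b.coord 2 z := by
    intro z; rw [hv2]; simp
  have hv : ∀ w z, X.B v2 z = w → X.B z v2 = w := fun w z h => by rw [X.symm, h]
  set v3 := x1 • b 1 + x2 • b 2 with hv3
  have hc : ∀ i j, b.coord i (b j) = if j = i then 1 else 0 := by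
    intro i j; rw [Module.Basis.coord_apply, b.repr_self, Finsupp.single_apply]
  have e1 : X.B v2 (b 0) = 1 := by rw [hy]; simp [hc, i01, i02]
  have e2 : X.B v2 v3 = 1 := by
    rw [hy]; simp only [hv3, map_add, map_smul, hc, i01.symm, i02.symm, i12, i12.symm]
    simp; linarith
  have e3 : X.B (b 0) v3 = 0 := by
    rw [hv3]; simp only [map_add, map_smul, smul_eq_mul]; linarith
  have e3' : X.B v3 (b 0) = 0 := by rw [X.symm, e3]
  have e1' : X.B (b 0) v2 = 1 := by rw [X.symm, e1]
  have e2' : X.B v3 v2 = 1 := by rw [X.symm, e2]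
  refine ⟨![b 0, v2, v3], by simpa using e1', by simpa using e2, by simpa using e3, ?_⟩
  simp only [Matrix.cons_val_zero, Matrix.cons_val_one, Matrix.cons_val]
  set a1 := X.B (b 0) (b 0) with h1
  set a2 := X.B v2 v2 with h2
  set a3 := X.B v3 v3 with h3
  intro hK
  set k := a1 * a2 - 1 with hk
  have hku : k * k = 1 := by
    have : k * (a2 * a3 - 1) = 1 := by rw [hk] at hK ⊢; linear_combination a2 * hK
    rcases Int.isUnit_iff.mp (IsUnit.of_mul_eq_one _ this) with h | h <;> rw [h] <;> norm_num
  have hz := hani (b 0 - a1 • v2 + k • v3) (by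
    simp only [map_sub, map_add, map_smul, LinearMap.sub_apply, LinearMap.add_apply,
      LinearMap.smul_apply, smul_eq_mul, ← h1, ← h2, ← h3, e1, e2, e3, e1', e2', e3']
    rw [hk] at hK ⊢
    linear_combination (a1 * a2 - 1) * hK)
  have z1 := congrArg (b.coord 1) hz
  have z2 := congrArg (b.coord 2) hz
  simp only [hv3, map_sub, map_add, map_smul, hc, i01, i02, i12, i12.symm, map_zero, smul_eq_mul] at z1 z2
  simp at z1 z2
  have hdv : a1 * (k * (s1 * b.coord 1 v2 + s2 * b.coord 2 v2)) = 1 := by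
    simp only [Module.Basis.coord_apply]
    linear_combination hs - (k * s1) * z1 - (k * s2) * z2 + (s1 * x1 + s2 * x2) * hku
  exact hno (b 0) (Int.isUnit_iff.mp (IsUnit.of_mul_eq_one _ hdv))

theorem main : ∀ (r : ℕ) (X : ZLat), Module.finrank ℤ X.M = r → X.Uni → SD X := by
  intro r
  induction r using Nat.strong_induction_on with
  | _ r ih =>
    intro X hr hX
    have ih' : ∀ Y : ZLat, Y.Uni → Module.finrank ℤ Y.M < r → SD Y :=
      fun Y hY hlt => ih _ hlt Y rfl hY
    by_cases h0 : r = 0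
    · have hs : Subsingleton X.M := by
        rw [h0] at hr
        exact Module.finrank_zero_iff.mp hr
      refine (IsD.iso ?_ IsD.empty).sd
      let e : X.M ≃ₗ[ℤ] (Fin 0 → ℤ) := LinearEquiv.ofFinrankEq _ _ (by rw [hr, h0]; simp)
      refine ⟨e, fun x y => ?_⟩
      rw [Subsingleton.elim x 0, map_zero, LinearMap.zero_apply]
      refine (dg_B _ _ _).trans ?_
      simp
    by_cases hani : ∀ x, X.B x x = 0 → x = 0
    · by_cases hno : ∃ x, X.B x x = 1 ∨ X.B x x = -1
      · obtain ⟨x, hx⟩ := hno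
        obtain ⟨N, hN, hNr, hsd⟩ := split_one X hX x hx
        exact hsd (ih' N hN (by omega))
      · have h6 : 6 ≤ r := by
          by_contra h
          exact hno (small_norm X hX (by omega) (by omega) hani)
        push Not at hno
        obtain ⟨v, h01, h12, h02, hK⟩ := vecs X hX (by omega) hani (fun x => by
          have := hno x; tauto)
        exact step X hX r hr h6 ih' v h01 h12 h02 hK
    · push Not at hani
      obtain ⟨x, hx, hx0⟩ := hani
      refine iso_red 1 X hX (fun _ => x) ?_ (fun _ _ => hx) (fun Y hY hYr => ih' Y hY (by omega))
      exact LinearIndependent.of_subsingleton 0 hx0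

end ZLat

theorem pres_facts {n m : ℕ} (H : Type) [AddCommGroup H]
    (φ : H → H → QZ)
    (hφadd : ∀ x y z, φ (x + y) z = φ x z + φ y z)
    (hφadd' : ∀ x y z, φ x (y + z) = φ x y + φ x z)
    (A : Matrix (Fin n) (Fin n) ℤ) (hAsym : A.IsSymm) (hAdet : A.det ≠ 0)
    (B : Matrix (Fin m) (Fin m) ℤ) (hBsym : B.IsSymm) (hBdet : B.det ≠ 0)
    (γ : Fin n → H) (hγ : IsPresentation φ A γ)
    (η : Fin m → H) (hη : IsPresentation φ B η) :
    ∃ (X : Matrix (Fin m) (Fin n) ℤ) (Z : Matrix (Fin n) (Fin m) ℤ) (S : Matrix (Fin m) (Fin m) ℤ),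
      S.IsSymm ∧ (∀ i, ∑ j, X i j • γ j = η i) ∧ Xᵀ * B = A * Z ∧ X * Z = 1 + S * B := by
  obtain ⟨hγ1, hγ2, hγ3⟩ := hγ
  obtain ⟨hη1, hη2, hη3⟩ := hη
  obtain ⟨X, hX⟩ : ∃ X : Matrix (Fin m) (Fin n) ℤ, ∀ i, ∑ j, X i j • γ j = η i := by
    choose X hX using fun i => hγ1 (η i)
    exact ⟨X, hX⟩
  have hcol : ∀ k, ∃ w, (fun j => (Xᵀ * B : Matrix (Fin n) (Fin m) ℤ) j k) = A *ᵥ w := by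
    intro k
    rw [← hγ2]
    have h0 : ∑ i, (B i k) • η i = 0 := by
      rw [hη2]
      exact ⟨Pi.single k 1, by ext i; simp⟩
    rw [← h0]
    simp only [← hX, Finset.smul_sum, Matrix.mul_apply, Finset.sum_smul]
    rw [Finset.sum_comm]
    refine Finset.sum_congr rfl fun i _ => Finset.sum_congr rfl fun j _ => ?_
    change (X i j * B i k) • γ j = _
    rw [smul_smul, mul_comm]
  choose W hW using hcol
  let Z : Matrix (Fin n) (Fin m) ℤ := fun j k => W k j
  have hZ : Xᵀ * B = A * Z := by
    ext j k
    exact congrFun (hW k) j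
  let Φ : H →+ H →+ QZ := AddMonoidHom.mk' (fun x => AddMonoidHom.mk' (φ x) (hφadd' x)) (by
    intro x y; ext z; exact hφadd x y z)
  have hΦ : ∀ x y, Φ x y = φ x y := fun _ _ => rfl
  set Q := mQ X * (mQ A)⁻¹ * (mQ X)ᵀ - (mQ B)⁻¹ with hQ
  have hint : ∀ i k, ∃ s : ℤ, (s : ℚ) = Q i k := by
    intro i k
    have h1 : φ (η i) (η k) = (((mQ X * (mQ A)⁻¹ * (mQ X)ᵀ) i k : ℚ) : QZ) := by
      rw [← hΦ, ← hX i, ← hX k]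
      simp only [map_sum, map_zsmul, AddMonoidHom.finsetSum_apply, AddMonoidHom.coe_smul,
        Pi.smul_apply, hΦ, hγ3, Matrix.mul_apply]
      rw [← QuotientAddGroup.mk'_apply]
      simp only [map_sum]
      refine Finset.sum_congr rfl fun l _ => ?_
      rw [Finset.sum_mul, map_sum, Finset.smul_sum]
      refine Finset.sum_congr rfl fun j _ => ?_
      rw [QuotientAddGroup.mk'_apply]
      rw [show mQ X i j * (mQ A)⁻¹ j l * (mQ X)ᵀ l k = (X k l) • ((X i j) • (mQ A)⁻¹ j l) by
        simp [mQ]; ring]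
      rfl
    rw [hη3] at h1
    have h2 : ((Q i k : ℚ) : QZ) = 0 := by
      rw [hQ, Matrix.sub_apply, AddCircle.coe_sub, h1, sub_self]
    rw [AddCircle.coe_eq_zero_iff] at h2
    obtain ⟨s, hs⟩ := h2
    exact ⟨s, by simpa using hs⟩
  obtain ⟨S, hS⟩ : ∃ S : Matrix (Fin m) (Fin m) ℤ, ∀ i k, (S i k : ℚ) = Q i k := by
    choose S hS using hint
    exact ⟨S, hS⟩
  have hSQ : mQ S = Q := by ext i k; exact hS i k
  have hmul : ∀ {a b c : ℕ} (M : Matrix (Fin a) (Fin b) ℤ) (N : Matrix (Fin b) (Fin c) ℤ),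
      mQ (M * N) = mQ M * mQ N := by
    intro a b c M N; ext i j; simp [mQ, Matrix.mul_apply]
  have htr : ∀ {a b : ℕ} (M : Matrix (Fin a) (Fin b) ℤ), mQ Mᵀ = (mQ M)ᵀ := fun M => rfl
  have hinj : ∀ {a b : ℕ} (M N : Matrix (Fin a) (Fin b) ℤ), mQ M = mQ N → M = N := by
    intro a b M N h; ext i j
    have := congrFun (congrFun h i) j
    simpa [mQ] using this
  have hdet : ∀ {a : ℕ} (M : Matrix (Fin a) (Fin a) ℤ), M.det ≠ 0 → IsUnit (mQ M).det := by
    intro a M h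
    have : (mQ M).det = ((M.det : ℤ) : ℚ) := (Int.cast_det M).symm
    rw [this, isUnit_iff_ne_zero]; exact_mod_cast h
  refine ⟨X, Z, S, ?_, hX, hZ, ?_⟩
  · apply hinj
    have hA : (mQ A)ᵀ = mQ A := by rw [← htr, hAsym]
    have hB : (mQ B)ᵀ = mQ B := by rw [← htr, hBsym]
    rw [htr, hSQ, hQ, Matrix.transpose_sub, Matrix.transpose_mul, Matrix.transpose_mul,
      Matrix.transpose_nonsing_inv, Matrix.transpose_nonsing_inv, hA, hB, Matrix.transpose_transpose,
      Matrix.mul_assoc]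
  · apply hinj
    have h3 : mQ Z = (mQ A)⁻¹ * ((mQ X)ᵀ * mQ B) := by
      rw [← htr, ← hmul]
      have : mQ (Xᵀ * B) = mQ A * mQ Z := by rw [hZ, hmul]
      rw [this]
      rw [← Matrix.mul_assoc, Matrix.nonsing_inv_mul _ (hdet A hAdet), Matrix.one_mul]
    have h4 : mQ (1 + S * B) = 1 + mQ S * mQ B := by
      rw [← hmul]
      ext i j; simp [mQ, Matrix.one_apply]
    rw [h4, hmul, h3, hSQ, hQ, Matrix.sub_mul, Matrix.nonsing_inv_mul _ (hdet B hBdet)]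
    simp only [Matrix.mul_assoc]
    abel

namespace ZLat

def hypS {m : ℕ} (S : Matrix (Fin m) (Fin m) ℤ) (h : S.IsSymm) : ZLat where
  M := (Fin m → ℤ) × (Fin m → ℤ)
  B := LinearMap.mk₂ ℤ (fun x y => - (x.1 ⬝ᵥ S *ᵥ y.1) + x.1 ⬝ᵥ y.2 + x.2 ⬝ᵥ y.1)
    (by intro x x' y; simp only [Prod.fst_add, Prod.snd_add, add_dotProduct]; ring)
    (by intro c x y; simp only [Prod.smul_fst, Prod.smul_snd, smul_dotProduct, smul_eq_mul]; ring)
    (by intro x x' y; simp only [Prod.fst_add, Prod.snd_add, dotProduct_add, Matrix.mulVec_add]; ring)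
    (by intro c x y; simp only [Prod.smul_fst, Prod.smul_snd, dotProduct_smul, Matrix.mulVec_smul, smul_eq_mul]; ring)
  symm x y := by
    simp only [LinearMap.mk₂_apply]
    rw [Matrix.dotProduct_mulVec, dotProduct_comm, ← Matrix.mulVec_transpose, h,
      dotProduct_comm x.1 y.2, dotProduct_comm x.2 y.1]
    ring

theorem hypS_B {m : ℕ} (S : Matrix (Fin m) (Fin m) ℤ) (h : S.IsSymm)
    (x y : (Fin m → ℤ) × (Fin m → ℤ)) :
    (hypS S h).B x y = - (x.1 ⬝ᵥ S *ᵥ y.1) + x.1 ⬝ᵥ y.2 + x.2 ⬝ᵥ y.1 := rfl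

theorem fun_vec {m : ℕ} (A : Matrix (Fin m) (Fin m) ℤ) (h : A.IsSymm) (f : (ofMat A h).M →ₗ[ℤ] ℤ)
    (y : Fin m → ℤ) : f y = (fun i => f (Pi.single i (1 : ℤ) : Fin m → ℤ)) ⬝ᵥ y := by
  have : y = ∑ i, y i • (Pi.single i (1 : ℤ) : Fin m → ℤ) := by
    ext j; simp [Finset.sum_apply, Pi.single_apply]
  have h2 : f y = ∑ i, y i • f (Pi.single i (1 : ℤ) : Fin m → ℤ) := by
    conv_lhs => rw [this]
    refine (map_sum f _ _).trans ?_
    exact Finset.sum_congr rfl fun i _ => map_smul f _ _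
  rw [h2]
  simp [dotProduct, mul_comm]

theorem prod_fun {P Q : Type} [AddCommGroup P] [AddCommGroup Q] (f : P × Q →ₗ[ℤ] ℤ) (z : P × Q) :
    f z = f (z.1, 0) + f (0, z.2) := by
  rw [← map_add]; simp

theorem hypS_uni {m : ℕ} (S : Matrix (Fin m) (Fin m) ℤ) (h : S.IsSymm) : (hypS S h).Uni := by
  intro (f : (ofMat S h).M × (ofMat S h).M →ₗ[ℤ] ℤ)
  let g1 : Fin m → ℤ := fun i => f.comp (LinearMap.inl ℤ _ _) (Pi.single i (1 : ℤ) : Fin m → ℤ)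
  let g2 : Fin m → ℤ := fun i => f.comp (LinearMap.inr ℤ _ _) (Pi.single i (1 : ℤ) : Fin m → ℤ)
  refine ⟨(g2, g1 + g2 ᵥ* S), LinearMap.ext fun (y : (Fin m → ℤ) × (Fin m → ℤ)) => ?_⟩
  refine (hypS_B _ _ _ _).trans ?_
  have h1 := fun_vec S h (f.comp (LinearMap.inl ℤ _ _)) y.1
  have h2 := fun_vec S h (f.comp (LinearMap.inr ℤ _ _)) y.2
  have h3 : f y = f.comp (LinearMap.inl ℤ _ _) y.1 + f.comp (LinearMap.inr ℤ _ _) y.2 := prod_fun f y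
  refine Eq.trans ?_ h3.symm
  refine Eq.trans ?_ (congrArg₂ (· + ·) h1 h2).symm
  change - (g2 ⬝ᵥ S *ᵥ y.1) + g2 ⬝ᵥ y.2 + (g1 + g2 ᵥ* S) ⬝ᵥ y.1 = g1 ⬝ᵥ y.1 + g2 ⬝ᵥ y.2
  rw [add_dotProduct, ← Matrix.dotProduct_mulVec]
  ring

section rel
variable {n m : ℕ} {H : Type} [AddCommGroup H] (LA LB : ZLat) (sA : Fin n → LA.M) (sB : Fin m → LB.M)
  (γ : Fin n → H) (η : Fin m → H)

def Rel (U V : ZLat) : Prop :=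
  ∃ e : (U.M × LA.M) ≃ₗ[ℤ] (V.M × LB.M),
    (∀ x y, (V.prod LB).B (e x) (e y) = (U.prod LA).B x y) ∧
    ∀ f : (V.M × LB.M) →ₗ[ℤ] ℤ,
      ∑ j, f (e ((0 : U.M), sA j)) • γ j = ∑ i, f ((0 : V.M), sB i) • η i

variable {LA LB sA sB γ η}

theorem Rel.iso {U V U' V' : ZLat} (hU : Iso U' U) (hV : Iso V V') :
    Rel LA LB sA sB γ η U V → Rel LA LB sA sB γ η U' V' := by
  rintro ⟨e, he, hf⟩
  obtain ⟨u, hu⟩ := hU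
  obtain ⟨v, hv⟩ := hV
  refine ⟨((u.prodCongr (LinearEquiv.refl ℤ _)).trans e).trans (v.prodCongr (LinearEquiv.refl ℤ _)),
    ?_, ?_⟩
  · intro x y
    have h1 := he (u x.1, x.2) (u y.1, y.2)
    change V.B _ _ + LB.B _ _ = U.B _ _ + _ at h1
    change V'.B (v _) (v _) + LB.B _ _ = U'.B x.1 y.1 + _
    rw [hv, ← hu]
    exact h1
  · intro f
    have := hf (f.comp (v.prodCongr (LinearEquiv.refl ℤ _)).toLinearMap)
    simpa using this

theorem Rel.prod {U V : ZLat} (K : ZLat) :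
    Rel LA LB sA sB γ η U V → Rel LA LB sA sB γ η (K.prod U) (K.prod V) := by
  rintro ⟨e, he, hf⟩
  refine ⟨((LinearEquiv.prodAssoc ℤ K.M U.M LA.M).trans
    ((LinearEquiv.refl ℤ K.M).prodCongr e)).trans (LinearEquiv.prodAssoc ℤ K.M V.M LB.M).symm,
    ?_, ?_⟩
  · intro x y
    have h1 := he (x.1.2, x.2) (y.1.2, y.2)
    change V.B _ _ + LB.B _ _ = U.B _ _ + _ at h1
    change (K.B x.1.1 y.1.1 + V.B _ _) + LB.B _ _ = (K.B x.1.1 y.1.1 + U.B x.1.2 y.1.2) + _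
    rw [add_assoc, add_assoc]
    exact congrArg _ h1
  · intro f
    exact hf (f.comp ((LinearEquiv.prodAssoc ℤ K.M V.M LB.M).symm.toLinearMap.comp
      (LinearMap.inr ℤ K.M (V.M × LB.M))))

theorem rel_base (W : ZLat) (hW : W.Uni)
    (hγ : ∀ f : LA.M →ₗ[ℤ] ℤ, ∑ j, f (sA j) • γ j = 0 ↔ ∃ a, LA.B a = f)
    (hη : ∀ f : LB.M →ₗ[ℤ] ℤ, ∑ j, f (sB j) • η j = 0 ↔ ∃ a, LB.B a = f)
    (hη1 : ∀ h : H, ∃ f : LB.M →ₗ[ℤ] ℤ, ∑ j, f (sB j) • η j = h)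
    (i : LB.M →ₗ[ℤ] (W.prod LA).M) (π : (W.prod LA).M →ₗ[ℤ] LB.M)
    (h1 : ∀ b, π (i b) = b) (h2 : ∀ b z, (W.prod LA).B (i b) z = LB.B b (π z))
    (hgX : ∀ g : LB.M →ₗ[ℤ] ℤ, ∑ j, g (π ((0 : W.M), sA j)) • γ j = ∑ k, g (sB k) • η k) :
    ∃ C : ZLat, C.Uni ∧ Rel LA LB sA sB γ η W C := by
  obtain ⟨zA, hzA⟩ : ∃ zA : Fin n → (W.prod LA).M, zA = fun j => ((0 : W.M), sA j) := ⟨_, rfl⟩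
  replace hgX : ∀ g : LB.M →ₗ[ℤ] ℤ, ∑ j, g (π (zA j)) • γ j = ∑ k, g (sB k) • η k := by
    rw [hzA]; exact hgX
  obtain ⟨e, he, he1, he2⟩ := split_gen (W.prod LA) LB i π h1 h2
  have rep : ∀ f : (W.prod LA).M →ₗ[ℤ] ℤ, ∑ j, f (zA j) • γ j = 0 → ∃ y, (W.prod LA).B y = f := by
    intro f hf
    rw [hzA] at hf
    obtain ⟨a, ha⟩ := (hγ (f.comp (LinearMap.inr ℤ W.M LA.M))).mp hf
    obtain ⟨w, hw⟩ := hW (f.comp (LinearMap.inl ℤ W.M LA.M))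
    refine ⟨(w, a), LinearMap.ext fun (z : W.M × LA.M) => ?_⟩
    refine Eq.trans ?_ (prod_fun f z).symm
    change W.B w z.1 + LA.B a z.2 = _
    congr 1
    · exact LinearMap.congr_fun hw z.1
    · exact LinearMap.congr_fun ha z.2
  have hEi : ∀ y b, (W.prod LA).B y (i b) = LB.B (π y) b := by
    intro y b
    rw [(W.prod LA).symm, LB.symm, h2]
  let C := (W.prod LA).sub (LinearMap.ker π)
  have hCU : C.Uni := by
    intro (f : LinearMap.ker π →ₗ[ℤ] ℤ)
    let f' : (W.prod LA).M →ₗ[ℤ] ℤ := f.comp ((LinearMap.snd ℤ LB.M (LinearMap.ker π)).comp e.toLinearMap)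
    have hf' : ∀ z, f' z = f (e z).2 := fun z => rfl
    obtain ⟨g, hg⟩ := hη1 (∑ j, f' (zA j) • γ j)
    obtain ⟨y, hy⟩ := rep (f' - g.comp π) (by
      simp only [LinearMap.sub_apply, sub_smul, Finset.sum_sub_distrib]
      rw [← hg, sub_eq_zero]
      exact (hgX g).symm)
    have hg0 : ∑ i, g (sB i) • η i = 0 := by
      rw [hη]
      refine ⟨- π y, LinearMap.ext fun b => ?_⟩
      have h4 : (W.prod LA).B y (i b) = (f' - g.comp π) (i b) := by rw [hy]
      have h5 : f' (i b) = 0 := by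
        rw [hf']
        have : (e (i b)).2 = 0 := Subtype.ext ((he2 (i b)).trans (by
          rw [h1, sub_self]; rfl))
        rw [this, map_zero]
      rw [hEi, LinearMap.sub_apply, h5, LinearMap.comp_apply, h1] at h4
      rw [map_neg, LinearMap.neg_apply, h4]
      ring
    obtain ⟨y', hy'⟩ := rep f' (by rw [← hg, hg0])
    refine ⟨(e y').2, LinearMap.ext fun (c : LinearMap.ker π) => ?_⟩
    change (W.prod LA).B ((e y').2 : (W.prod LA).M) (c : (W.prod LA).M) = f c
    have hc : π (c : (W.prod LA).M) = 0 := c.2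
    have hec : (e (c : (W.prod LA).M)).2 = c := Subtype.ext ((he2 _).trans (by
      rw [hc, map_zero, sub_zero]))
    have h9 := he y' c
    have h10 : (e (c : (W.prod LA).M)).1 = 0 := (he1 _).trans hc
    rw [h10, hec, map_zero, zero_add, hy', hf', hec] at h9
    exact h9
  refine ⟨C, hCU, e.trans (LinearEquiv.prodComm ℤ LB.M (LinearMap.ker π)), ?_, ?_⟩
  · intro x y
    refine Eq.trans ?_ (he x y)
    exact add_comm _ _
  · intro f
    obtain ⟨(c : LinearMap.ker π), hc⟩ := hCU (f.comp (LinearMap.inl ℤ C.M LB.M))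
    let g : LB.M →ₗ[ℤ] ℤ := f.comp (LinearMap.inr ℤ C.M LB.M)
    refine Eq.trans ?_ (hgX g)
    have hcc : π c.1 = 0 := c.2
    let c' : W.M × LA.M := c.1
    have key : ∀ j, f ((e.trans (LinearEquiv.prodComm ℤ LB.M (LinearMap.ker π))) (zA j)) =
        LA.B c'.2 (sA j) + g (π (zA j)) := by
      intro j
      change f ((e (zA j)).2, (e (zA j)).1) = _
      refine (prod_fun f _).trans ?_
      congr 1
      · have h3 : C.B c (e (zA j)).2 = f ((e (zA j)).2, 0) := LinearMap.congr_fun hc (e (zA j)).2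
        refine h3.symm.trans ?_
        change (W.prod LA).B c.1 ((e (zA j)).2 : (W.prod LA).M) = _
        rw [he2 (zA j), map_sub, hEi, hcc, map_zero, LinearMap.zero_apply, sub_zero, hzA]
        change W.B c'.1 0 + LA.B c'.2 _ = _
        rw [map_zero, zero_add]
        rfl
      · rw [he1 (zA j)]
        rfl
    rw [hzA] at key
    refine (Finset.sum_congr rfl fun j _ => congrArg (· • γ j) (key j)).trans ?_
    simp only [add_smul, Finset.sum_add_distrib]
    rw [(hγ _).mpr ⟨c'.2, rfl⟩, zero_add, hzA]

theorem rel_diag {U V : ZLat} (hU : U.Uni) (hV : V.Uni) (h : Rel LA LB sA sB γ η U V) :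
    ∃ (p q : ℕ) (DA : Fin (p+1) → ℤ) (DB : Fin q → ℤ), (∀ i, DA i = 1 ∨ DA i = -1) ∧
      (∀ i, DB i = 1 ∨ DB i = -1) ∧ Rel LA LB sA sB γ η (dg DA) (dg DB) := by
  obtain ⟨K1, hK1, hU1⟩ := main _ U rfl hU
  obtain ⟨K2, hK2, hV2⟩ := main _ V rfl hV
  let K0 := dg (fun _ : Fin 1 => (1 : ℤ))
  have hK0 : IsD K0 := IsD.mk _ (fun _ => Or.inl rfl) (Iso.refl _)
  have hr := ((h.prod K1).prod K2).prod K0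
  have hI1 : IsD (K0.prod (K2.prod (K1.prod U))) := hK0.prod (hK2.prod hU1)
  have hI2 : IsD (K0.prod (K2.prod (K1.prod V))) :=
    IsD.iso ((Iso.refl _).prod (Iso.lcomm _ _ _)) (hK0.prod (hK1.prod hV2))
  obtain ⟨p, DA, hDA, iA⟩ := hI1
  obtain ⟨q, DB, hDB, iB⟩ := hI2
  have hp : 1 ≤ p := by
    obtain ⟨e, -⟩ := iA
    have h1 := e.finrank_eq
    have h2 : Module.finrank ℤ (dg DA).M = p := by
      change Module.finrank ℤ (Fin p → ℤ) = p
      simp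
    have h3 : Module.finrank ℤ (K0.prod (K2.prod (K1.prod U))).M =
      Module.finrank ℤ K0.M + Module.finrank ℤ (K2.prod (K1.prod U)).M := Module.finrank_prod
    have h4 : Module.finrank ℤ K0.M = 1 := by
      change Module.finrank ℤ (Fin 1 → ℤ) = 1
      simp
    omega
  obtain ⟨p, rfl⟩ : ∃ p', p = p' + 1 := ⟨p - 1, by omega⟩
  exact ⟨p, q, DA, DB, hDA, hDB, hr.iso iA.symm' iB⟩

end rel
end ZLat

namespace ZLat

def iMap {n m : ℕ} (B : Matrix (Fin m) (Fin m) ℤ) (Z : Matrix (Fin n) (Fin m) ℤ) :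
    (Fin m → ℤ) →ₗ[ℤ] ((Fin m → ℤ) × (Fin m → ℤ)) × (Fin n → ℤ) :=
  ((B.mulVecLin).prod 0).prod Z.mulVecLin

def piMap {n m : ℕ} (S : Matrix (Fin m) (Fin m) ℤ) (X : Matrix (Fin m) (Fin n) ℤ) :
    ((Fin m → ℤ) × (Fin m → ℤ)) × (Fin n → ℤ) →ₗ[ℤ] (Fin m → ℤ) :=
  ((-S.mulVecLin).coprod LinearMap.id).coprod X.mulVecLin

theorem piMap_apply {n m : ℕ} (S : Matrix (Fin m) (Fin m) ℤ) (X : Matrix (Fin m) (Fin n) ℤ)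
    (z : ((Fin m → ℤ) × (Fin m → ℤ)) × (Fin n → ℤ)) :
    piMap S X z = -(S *ᵥ z.1.1) + z.1.2 + X *ᵥ z.2 := rfl

theorem iMap_apply {n m : ℕ} (B : Matrix (Fin m) (Fin m) ℤ) (Z : Matrix (Fin n) (Fin m) ℤ)
    (b : Fin m → ℤ) : iMap B Z b = ((B *ᵥ b, 0), Z *ᵥ b) := rfl

theorem pres_fun {k : ℕ} {H : Type} [AddCommGroup H]
    (A : Matrix (Fin k) (Fin k) ℤ) (hA : A.IsSymm) (γ : Fin k → H)
    (h2 : ∀ v : Fin k → ℤ, (∑ i, v i • γ i) = 0 ↔ ∃ w, v = A *ᵥ w)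
    (f : (ofMat A hA).M →ₗ[ℤ] ℤ) :
    ∑ j, f (Pi.single j (1 : ℤ) : Fin k → ℤ) • γ j = 0 ↔ ∃ a, (ofMat A hA).B a = f := by
  rw [h2 (fun j => f (Pi.single j (1 : ℤ) : Fin k → ℤ))]
  have hs : ∀ (a y : Fin k → ℤ), a ⬝ᵥ A *ᵥ y = (A *ᵥ a) ⬝ᵥ y := by
    intro a y
    rw [Matrix.dotProduct_mulVec, ← Matrix.mulVec_transpose, hA]
  constructor
  · rintro ⟨w, hw⟩
    refine ⟨w, LinearMap.ext fun (y : Fin k → ℤ) => ?_⟩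
    refine (ofMat_B _ _ _ _).trans ?_
    refine Eq.trans ?_ (fun_vec A hA f y).symm
    rw [hw, hs]
  · rintro ⟨(a : Fin k → ℤ), rfl⟩
    refine ⟨a, ?_⟩
    ext j
    refine (ofMat_B _ _ _ _).trans ?_
    rw [hs]
    simp

theorem inst {n m : ℕ} {H : Type} [AddCommGroup H] 
    (A : Matrix (Fin n) (Fin n) ℤ) (hAsym : A.IsSymm)
    (B : Matrix (Fin m) (Fin m) ℤ) (hBsym : B.IsSymm)
    (γ : Fin n → H) (hγ2 : ∀ v : Fin n → ℤ, (∑ i, v i • γ i) = 0 ↔ ∃ w, v = A *ᵥ w)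
    (η : Fin m → H) (hη1 : Function.Surjective fun v : Fin m → ℤ => ∑ i, v i • η i)
    (hη2 : ∀ v : Fin m → ℤ, (∑ i, v i • η i) = 0 ↔ ∃ w, v = B *ᵥ w)
    (X : Matrix (Fin m) (Fin n) ℤ) (Z : Matrix (Fin n) (Fin m) ℤ) (S : Matrix (Fin m) (Fin m) ℤ)
    (hS : S.IsSymm) (hX : ∀ i, ∑ j, X i j • γ j = η i) (hXB : Xᵀ * B = A * Z)
    (hXZ : X * Z = 1 + S * B) :
    ∃ C : ZLat, C.Uni ∧ Rel (ofMat A hAsym) (ofMat B hBsym)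
      (fun j => (Pi.single j (1 : ℤ) : Fin n → ℤ)) (fun j => (Pi.single j (1 : ℤ) : Fin m → ℤ))
      γ η (hypS S hS) C := by
  refine rel_base (hypS S hS) (hypS_uni S hS) (pres_fun A hAsym γ hγ2) (pres_fun B hBsym η hη2)
    ?_ (iMap B Z) (piMap S X) ?_ ?_ ?_
  · intro h
    obtain ⟨v, hv⟩ := hη1 h
    refine ⟨(Matrix.toLinearMap₂' ℤ (1 : Matrix (Fin m) (Fin m) ℤ) v), ?_⟩
    rw [← hv]
    refine Finset.sum_congr rfl fun j _ => ?_
    congr 1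
    refine (Matrix.toLinearMap₂'_apply' _ _ _).trans ?_
    rw [Matrix.one_mulVec, dotProduct_single, mul_one]
  · intro (b : Fin m → ℤ)
    refine (piMap_apply _ _ _).trans ?_
    change -(S *ᵥ (B *ᵥ b)) + 0 + X *ᵥ (Z *ᵥ b) = b
    simp only [Matrix.mulVec_mulVec, hXZ, Matrix.add_mulVec, Matrix.one_mulVec]
    abel
  · intro (b : Fin m → ℤ) (z : ((Fin m → ℤ) × (Fin m → ℤ)) × (Fin n → ℤ))
    have e1 : (ofMat B hBsym).B b (piMap S X z) = b ⬝ᵥ B *ᵥ (piMap S X z) := ofMat_B _ _ _ _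
    refine Eq.trans ?_ e1.symm
    have e2 : (ofMat A hAsym).B (Z *ᵥ b) z.2 = (Z *ᵥ b) ⬝ᵥ A *ᵥ z.2 := ofMat_B _ _ _ _
    have e3 : (hypS S hS).B (B *ᵥ b, 0) z.1 =
      - ((B *ᵥ b) ⬝ᵥ S *ᵥ z.1.1) + (B *ᵥ b) ⬝ᵥ z.1.2 + 0 ⬝ᵥ z.1.1 := rfl
    change (hypS S hS).B (B *ᵥ b, 0) z.1 + (ofMat A hAsym).B (Z *ᵥ b) z.2 = _
    rw [e2, e3, piMap_apply]
    have t1 : B *ᵥ b = b ᵥ* B := by rw [← Matrix.mulVec_transpose, hBsym]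
    have t2 : Z *ᵥ b = b ᵥ* Zᵀ := by rw [← Matrix.mulVec_transpose, Matrix.transpose_transpose]
    have t3 : Zᵀ * A = B * X := by
      have := congrArg Matrix.transpose hXB
      rw [Matrix.transpose_mul, Matrix.transpose_mul, Matrix.transpose_transpose, hAsym, hBsym] at this
      exact this.symm
    rw [t1, t2, ← Matrix.dotProduct_mulVec, ← Matrix.dotProduct_mulVec, ← Matrix.dotProduct_mulVec,
      Matrix.mulVec_mulVec _ Zᵀ, t3, zero_dotProduct, Matrix.mulVec_add, Matrix.mulVec_add,
      Matrix.mulVec_neg, dotProduct_add, dotProduct_add, dotProduct_neg, ← Matrix.mulVec_mulVec]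
    ring
  · intro g
    have e1 : ∀ j, (piMap S X ((0, 0), (Pi.single j (1 : ℤ) : Fin n → ℤ))) = fun k => X k j := by
      intro j
      rw [piMap_apply]
      ext k
      simp
    have e2 : ∀ j, g (piMap S X ((0, 0), (Pi.single j (1 : ℤ) : Fin n → ℤ))) =
        ∑ k, g (Pi.single k (1 : ℤ) : Fin m → ℤ) * X k j := by
      intro j
      rw [e1]
      exact fun_vec B hBsym g _
    refine (Finset.sum_congr rfl fun j _ => congrArg (· • γ j) (e2 j)).trans ?_
    simp only [Finset.sum_smul, ← hX, Finset.smul_sum, smul_smul]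
    rw [Finset.sum_comm]

end ZLat

namespace ZLat

abbrev blk {p n : ℕ} (D : Fin p → ℤ) (A : Matrix (Fin n) (Fin n) ℤ) :
    Matrix (Fin (p + n)) (Fin (p + n)) ℤ :=
  Matrix.reindex finSumFinEquiv finSumFinEquiv (Matrix.fromBlocks (Matrix.diagonal D) 0 0 A)

def ua (p n : ℕ) : (Fin (p + n) → ℤ) ≃ₗ[ℤ] (Fin p → ℤ) × (Fin n → ℤ) :=
  (LinearEquiv.funCongrLeft ℤ ℤ finSumFinEquiv).trans
    (LinearEquiv.sumArrowLequivProdArrow (Fin p) (Fin n) ℤ ℤ)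

theorem ua_1 {p n : ℕ} (x : Fin (p + n) → ℤ) : (ua p n x).1 = fun i => x (Fin.castAdd n i) := rfl
theorem ua_2 {p n : ℕ} (x : Fin (p + n) → ℤ) : (ua p n x).2 = fun i => x (Fin.natAdd p i) := rfl

theorem ua_l {p n : ℕ} (i : Fin p) : ua p n (Pi.single (Fin.castAdd n i) 1) = (Pi.single i 1, 0) := by
  refine Prod.ext ?_ ?_
  · rw [ua_1]; ext k; simp [Pi.single_apply, Fin.ext_iff]
  · rw [ua_2]; ext k; simp [Pi.single_apply, Fin.ext_iff]; omega

theorem ua_r {p n : ℕ} (i : Fin n) : ua p n (Pi.single (Fin.natAdd p i) 1) = (0, Pi.single i 1) := by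
  refine Prod.ext ?_ ?_
  · rw [ua_1]; ext k; simp [Pi.single_apply, Fin.ext_iff]; omega
  · rw [ua_2]; ext k; simp [Pi.single_apply, Fin.ext_iff]

theorem ua_symm_l {p n : ℕ} (z : (Fin p → ℤ) × (Fin n → ℤ)) (i : Fin p) :
    (ua p n).symm z (Fin.castAdd n i) = z.1 i := by
  conv_rhs => rw [← (ua p n).apply_symm_apply z]
  rfl

theorem ua_symm_r {p n : ℕ} (z : (Fin p → ℤ) × (Fin n → ℤ)) (i : Fin n) :
    (ua p n).symm z (Fin.natAdd p i) = z.2 i := by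
  conv_rhs => rw [← (ua p n).apply_symm_apply z]
  rfl

theorem blk_form {p n : ℕ} (D : Fin p → ℤ) (A : Matrix (Fin n) (Fin n) ℤ) (x y : Fin (p + n) → ℤ) :
    x ⬝ᵥ blk D A *ᵥ y = (ua p n x).1 ⬝ᵥ Matrix.diagonal D *ᵥ (ua p n y).1 +
      (ua p n x).2 ⬝ᵥ A *ᵥ (ua p n y).2 := by
  simp only [dotProduct, Matrix.mulVec, Fin.sum_univ_add, ua_1, ua_2, blk]
  simp

theorem mat_ext {N : ℕ} (M M' : Matrix (Fin N) (Fin N) ℤ)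
    (h : ∀ x y, x ⬝ᵥ M *ᵥ y = x ⬝ᵥ M' *ᵥ y) : M = M' := by
  ext i j
  have := h (Pi.single i 1) (Pi.single j 1)
  simpa using this

theorem final_raw {p n q m : ℕ} (hN : p + n = q + m) {H : Type} [AddCommGroup H]
    (DA : Fin p → ℤ) (DB : Fin q → ℤ) (A : Matrix (Fin n) (Fin n) ℤ) (B : Matrix (Fin m) (Fin m) ℤ)
    (γ : Fin n → H) (η : Fin m → H)
    (e : ((Fin p → ℤ) × (Fin n → ℤ)) ≃ₗ[ℤ] ((Fin q → ℤ) × (Fin m → ℤ)))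
    (he : ∀ x y, (e x).1 ⬝ᵥ Matrix.diagonal DB *ᵥ (e y).1 + (e x).2 ⬝ᵥ B *ᵥ (e y).2 =
      x.1 ⬝ᵥ Matrix.diagonal DA *ᵥ y.1 + x.2 ⬝ᵥ A *ᵥ y.2)
    (hf : ∀ f : ((Fin q → ℤ) × (Fin m → ℤ)) →ₗ[ℤ] ℤ,
      ∑ j, f (e (0, Pi.single j 1)) • γ j = ∑ i, f (0, Pi.single i 1) • η i) :
    ∃ P : Matrix (Fin (p + n)) (Fin (p + n)) ℤ, IsUnit P.det ∧
      blk DA A = Pᵀ * (Matrix.reindex (finCongr hN).symm (finCongr hN).symm (blk DB B)) * P ∧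
      (∀ i, ∑ j, P i j • Fin.append (fun _ => (0 : H)) γ j =
        Fin.append (fun _ => (0 : H)) η (finCongr hN i)) := by
  let T : (Fin (p + n) → ℤ) ≃ₗ[ℤ] (Fin (p + n) → ℤ) :=
    (((ua p n).trans e).trans (ua q m).symm).trans (LinearEquiv.funCongrLeft ℤ ℤ (finCongr hN))
  have hT : ∀ x i, T x i = (ua q m).symm (e (ua p n x)) (finCongr hN i) := fun _ _ => rfl
  refine ⟨LinearMap.toMatrix' T.toLinearMap, ?_, ?_, ?_⟩
  · rw [LinearMap.det_toMatrix']
    exact LinearEquiv.isUnit_det' T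
  · apply mat_ext
    intro x y
    have e1 : ∀ x, LinearMap.toMatrix' T.toLinearMap *ᵥ x = T x := fun x => by
      rw [LinearMap.toMatrix'_mulVec]; rfl
    rw [← Matrix.mulVec_mulVec, ← Matrix.mulVec_mulVec, e1, Matrix.dotProduct_mulVec _ (_)ᵀ,
      Matrix.vecMul_transpose, e1]
    have e2 : ∀ u v : Fin (q + m) → ℤ, (fun i => u (finCongr hN i)) ⬝ᵥ
        (Matrix.reindex (finCongr hN).symm (finCongr hN).symm (blk DB B)) *ᵥ
          (fun i => v (finCongr hN i)) = u ⬝ᵥ blk DB B *ᵥ v := by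
      intro u v
      simp only [dotProduct, Matrix.mulVec]
      rw [← Equiv.sum_comp (finCongr hN)]
      refine Finset.sum_congr rfl fun i _ => ?_
      congr 1
      rw [← Equiv.sum_comp (finCongr hN)]
      rfl
    refine Eq.trans ?_ (e2 ((ua q m).symm (e (ua p n x))) ((ua q m).symm (e (ua p n y)))).symm
    rw [blk_form, blk_form, LinearEquiv.apply_symm_apply, LinearEquiv.apply_symm_apply, he]
  · intro i
    let f : ((Fin q → ℤ) × (Fin m → ℤ)) →ₗ[ℤ] ℤ :=
      (LinearMap.proj (finCongr hN i)).comp (ua q m).symm.toLinearMap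
    have hff : ∀ z, f z = (ua q m).symm z (finCongr hN i) := fun _ => rfl
    have h1 := hf f
    rw [Fin.sum_univ_add]
    simp only [Fin.append_left, Fin.append_right, smul_zero, Finset.sum_const_zero, zero_add]
    have h2 : ∀ j, LinearMap.toMatrix' T.toLinearMap i (Fin.natAdd p j) = f (e (0, Pi.single j 1)) := by
      intro j
      rw [LinearMap.toMatrix'_apply, hff, ← ua_r, ← hT]
      congr 1
    simp only [h2]
    rw [h1]
    simp only [hff]
    generalize finCongr hN i = k
    refine Fin.addCases (fun k => ?_) (fun k => ?_) k
    · simp only [ua_symm_l, Fin.append_left]; simp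
    · simp only [ua_symm_r, Fin.append_right, Pi.single_apply]; simp

end ZLat
open ZLat
/-- given an `A`-presentation `γ` and a `B`-presentation `η` of a finite
linked group `(H, φ)`, there are stabilizations `Ã = diag(D_A, A)` and `B̃ = diag(D_B, B)`
of equal size `N = p + n = q + m` and a unimodular matrix `P` with `Ã = Pᵀ B̃ P` and
`P·(0,…,0,γ) = (0,…,0,η)` in `H^N`. -/
theorem stabilized_congruence_of_presentations {n m : ℕ} (H : Type) [AddCommGroup H]
    [Finite H] (φ : H → H → QZ)
    (hφsymm : ∀ x y, φ x y = φ y x)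
    (hφadd : ∀ x y z, φ (x + y) z = φ x z + φ y z)
    (hφadd' : ∀ x y z, φ x (y + z) = φ x y + φ x z)
    (A : Matrix (Fin n) (Fin n) ℤ) (hAsym : A.IsSymm) (hAdet : A.det ≠ 0)
    (B : Matrix (Fin m) (Fin m) ℤ) (hBsym : B.IsSymm) (hBdet : B.det ≠ 0)
    (γ : Fin n → H) (hγ : IsPresentation φ A γ)
    (η : Fin m → H) (hη : IsPresentation φ B η) :
    ∃ (p q : ℕ) (hN : p + n = q + m) (DA : Fin p → ℤ) (DB : Fin q → ℤ)
      (P : Matrix (Fin (p + n)) (Fin (p + n)) ℤ),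
      (∀ i, DA i = 1 ∨ DA i = -1) ∧ (∀ i, DB i = 1 ∨ DB i = -1) ∧
      P.det = 1 ∧
      Matrix.reindex finSumFinEquiv finSumFinEquiv
          (Matrix.fromBlocks (Matrix.diagonal DA) 0 0 A) =
        Pᵀ * (Matrix.reindex (finCongr hN).symm (finCongr hN).symm
          (Matrix.reindex finSumFinEquiv finSumFinEquiv
            (Matrix.fromBlocks (Matrix.diagonal DB) 0 0 B))) * P ∧
      (∀ i, ∑ j, P i j • Fin.append (fun _ => (0 : H)) γ j =
        Fin.append (fun _ => (0 : H)) η (finCongr hN i)) := by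
  obtain ⟨X, Z, S, hS, hX, hXB, hXZ⟩ :=
    pres_facts H φ hφadd hφadd' A hAsym hAdet B hBsym hBdet γ hγ η hη
  obtain ⟨C, hC, hR⟩ := inst A hAsym B hBsym γ hγ.2.1 η hη.1 hη.2.1 X Z S hS hX hXB hXZ
  obtain ⟨p, q, DA, DB, hDA, hDB, e, he, hf⟩ := rel_diag (hypS_uni S hS) hC hR
  let e' : ((Fin (p + 1) → ℤ) × (Fin n → ℤ)) ≃ₗ[ℤ] ((Fin q → ℤ) × (Fin m → ℤ)) := e
  have hN : (p + 1) + n = q + m := by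
    have := e'.finrank_eq
    simpa [Module.finrank_prod] using this
  obtain ⟨P, hP, hP1, hP2⟩ := final_raw hN DA DB A B γ η e' (by
    intro x y
    have h1 := he x y
    have h2 : ∀ (k : ℕ) (D : Fin k → ℤ) (u v : Fin k → ℤ),
      (dg D).B u v = u ⬝ᵥ Matrix.diagonal D *ᵥ v := fun k D u v => ofMat_B _ _ _ _
    have h3 := h2 q DB (e' x).1 (e' y).1
    have h4 := h2 (p + 1) DA x.1 y.1
    have h5 : (ofMat B hBsym).B (e' x).2 (e' y).2 = (e' x).2 ⬝ᵥ B *ᵥ (e' y).2 := ofMat_B _ _ _ _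
    have h6 : (ofMat A hAsym).B x.2 y.2 = x.2 ⬝ᵥ A *ᵥ y.2 := ofMat_B _ _ _ _
    rw [← h3, ← h4, ← h5, ← h6]
    exact h1) hf
  rcases Int.isUnit_iff.mp hP with hd | hd
  · exact ⟨p + 1, q, hN, DA, DB, P, hDA, hDB, hd, hP1, hP2⟩
  · let d : Fin (p + 1 + n) → ℤ := fun i => if i = Fin.castAdd n 0 then -1 else 1
    refine ⟨p + 1, q, hN, DA, DB, P * Matrix.diagonal d, hDA, hDB, ?_, ?_, ?_⟩
    · rw [Matrix.det_mul, hd, Matrix.det_diagonal, Finset.prod_ite_eq' Finset.univ]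
      simp
    · have : blk DA A = Matrix.diagonal d * blk DA A * Matrix.diagonal d := by
        ext i j
        rw [Matrix.mul_diagonal, Matrix.diagonal_mul]
        refine Fin.addCases (fun i => ?_) (fun i => ?_) i <;>
        refine Fin.addCases (fun j => ?_) (fun j => ?_) j
        · by_cases hij : i = j
          · subst hij
            by_cases h0 : i = 0 <;> simp [d, h0]
          · simp [hij]
        · simp
        · simp
        · have hne : ∀ i : Fin n, Fin.natAdd (p + 1) i ≠ Fin.castAdd n (0 : Fin (p + 1)) := by
            intro i h
            have := congrArg Fin.val h
            simp at this
          simp [d, hne]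
      refine this.trans ?_
      rw [hP1, Matrix.transpose_mul, Matrix.diagonal_transpose]
      simp only [Matrix.mul_assoc]
    · intro i
      rw [← hP2 i]
      refine Finset.sum_congr rfl fun j _ => ?_
      rw [Matrix.mul_diagonal]
      refine Fin.addCases (fun j => ?_) (fun j => ?_) j
      · simp
      · have hne : Fin.natAdd (p + 1) j ≠ Fin.castAdd n (0 : Fin (p + 1)) := by
          intro h
          have := congrArg Fin.val h
          simp at this
        simp [d, hne]
end
end

section
/- The symmetric bilinear form ψ_R on V₁ × V₁ is non-degenerate, and the lattice R = R₁ × R₁♯ is unimodular with respect to ψ_R: the dual lattice of R with respect to ψ_R equals R. -/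
open Matrix

noncomputable section

/-- `ψ_M(x, y) = xᵀ M y`, the bilinear form on `ℚᵏ` associated with an integer matrix `M`. -/
def psi {k : ℕ} (M : Matrix (Fin k) (Fin k) ℤ) (x y : Fin k → ℚ) : ℚ :=
  x ⬝ᵥ ((M.map (fun a => (a : ℚ))) *ᵥ y)

/-- A rational number is an integer. -/
def IsIntQ (q : ℚ) : Prop := ∃ a : ℤ, q = a

/-- A rational vector has integer entries, i.e. belongs to the lattice `ℤᵏ ⊂ ℚᵏ`. -/
def IsIntVec {k : ℕ} (x : Fin k → ℚ) : Prop := ∀ i, IsIntQ (x i)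

/-- `x` belongs to the dual lattice of `ℤᵏ` with respect to `ψ_M`. -/
def InDual {k : ℕ} (M : Matrix (Fin k) (Fin k) ℤ) (x : Fin k → ℚ) : Prop :=
  ∀ y, IsIntVec y → IsIntQ (psi M x y)

/-- The form `ψ_R` on `V₁ × V₁`:
`ψ_R((x,y),(x',y')) = ψ_A(x,y') + ψ_A(x',y) + ψ_A(y,y') − ψ_B(f(y),f(y'))`. -/
def psiR {n m : ℕ} (A : Matrix (Fin n) (Fin n) ℤ) (B : Matrix (Fin m) (Fin m) ℤ)
    (f : (Fin n → ℚ) →ₗ[ℚ] (Fin m → ℚ)) (u v : (Fin n → ℚ) × (Fin n → ℚ)) : ℚ :=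
  psi A u.1 v.2 + psi A v.1 u.2 + psi A u.2 v.2 - psi B (f u.2) (f v.2)

/-- Membership in the lattice `R = R₁ × R₁♯ ⊂ V₁ × V₁`. -/
def InR {n : ℕ} (A : Matrix (Fin n) (Fin n) ℤ) (u : (Fin n → ℚ) × (Fin n → ℚ)) : Prop :=
  IsIntVec u.1 ∧ InDual A u.2

lemma psi_symm_aux {k : ℕ} (M : Matrix (Fin k) (Fin k) ℤ) (h : M.IsSymm) (x y : Fin k → ℚ) :
    psi M x y = psi M y x := by
  have hM : (M.map (fun a => (a : ℚ)))ᵀ = M.map (fun a => (a : ℚ)) := by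
    rw [← Matrix.transpose_map, h.eq]
  unfold psi
  rw [Matrix.dotProduct_mulVec, ← Matrix.mulVec_transpose, hM, dotProduct_comm]

lemma psi_zero_right_aux {k : ℕ} (M : Matrix (Fin k) (Fin k) ℤ) (x : Fin k → ℚ) :
    psi M x 0 = 0 := by simp [psi]

lemma psi_zero_left_aux {k : ℕ} (M : Matrix (Fin k) (Fin k) ℤ) (x : Fin k → ℚ) :
    psi M 0 x = 0 := by simp [psi]

lemma psi_dualBasis_aux {k : ℕ} (M : Matrix (Fin k) (Fin k) ℤ) (h : M.det ≠ 0) (i : Fin k) :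
    ∃ e : Fin k → ℚ, ∀ x, psi M x e = x i := by
  have hd : IsUnit (M.map (fun a => (a : ℚ))).det := by
    have : (M.map (fun a => (a : ℚ))).det = (M.det : ℚ) :=
      ((Int.castRingHom ℚ).map_det M).symm
    rw [this]
    exact isUnit_iff_ne_zero.mpr (by exact_mod_cast h)
  refine ⟨(M.map (fun a => (a : ℚ)))⁻¹ *ᵥ (Pi.single i 1), fun x => ?_⟩
  unfold psi
  rw [Matrix.mulVec_mulVec, Matrix.mul_nonsing_inv _ hd, Matrix.one_mulVec]
  simp

lemma IsIntQ.add_aux {a b : ℚ} (ha : IsIntQ a) (hb : IsIntQ b) : IsIntQ (a + b) := by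
  obtain ⟨x, rfl⟩ := ha
  obtain ⟨y, rfl⟩ := hb
  exact ⟨x + y, by push_cast; rfl⟩

lemma IsIntQ.sub_aux {a b : ℚ} (ha : IsIntQ a) (hb : IsIntQ b) : IsIntQ (a - b) := by
  obtain ⟨x, rfl⟩ := ha
  obtain ⟨y, rfl⟩ := hb
  exact ⟨x - y, by push_cast; rfl⟩

/-- `ψ_R` is non-degenerate and the lattice `R = R₁ × R₁♯` is
unimodular with respect to `ψ_R`: its dual lattice equals `R`. -/
theorem R_unimodular {n m : ℕ}
    (A : Matrix (Fin n) (Fin n) ℤ) (hAsym : A.IsSymm) (hAdet : A.det ≠ 0)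
    (B : Matrix (Fin m) (Fin m) ℤ) (hBsym : B.IsSymm) (hBdet : B.det ≠ 0)
    (f : (Fin n → ℚ) →ₗ[ℚ] (Fin m → ℚ))
    (hfdual : ∀ x, InDual A x → InDual B (f x))
    (hfint : ∀ x, IsIntVec x → IsIntVec (f x))
    (hfinj : ∀ x, InDual A x → IsIntVec (f x) → IsIntVec x)
    (hfsurj : ∀ z, InDual B z → ∃ x, InDual A x ∧ IsIntVec (z - f x))
    (hfiso : ∀ x y, InDual A x → InDual A y → IsIntQ (psi B (f x) (f y) - psi A x y)) :
    (∀ u : (Fin n → ℚ) × (Fin n → ℚ), (∀ v, psiR A B f u v = 0) → u = 0) ∧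
    (∀ u : (Fin n → ℚ) × (Fin n → ℚ),
      (∀ v, InR A v → IsIntQ (psiR A B f u v)) ↔ InR A u) := by
  refine ⟨?_, fun u => ⟨fun h => ?_, fun hu v hv => ?_⟩⟩
  · rintro ⟨x, y⟩ h
    have hy : y = 0 := by
      funext i
      obtain ⟨e, he⟩ := psi_dualBasis_aux A hAdet i
      have := h (e, 0)
      simp only [psiR, map_zero, psi_zero_right_aux] at this
      rw [psi_symm_aux A hAsym e y, he y] at this
      simpa using this
    subst hy
    have hx : x = 0 := by
      funext i
      obtain ⟨e, he⟩ := psi_dualBasis_aux A hAdet i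
      have := h (0, e)
      simp only [psiR, map_zero, psi_zero_right_aux, psi_zero_left_aux] at this
      rw [he x] at this
      simpa using this
    subst hx
    rfl
  · obtain ⟨x, y⟩ := u
    have hy : InDual A y := by
      intro z hz
      have h1 := h (z, 0) ⟨hz, fun w _ => ⟨0, by simp [psi_zero_left_aux]⟩⟩
      simp only [psiR, map_zero, psi_zero_right_aux] at h1
      rw [psi_symm_aux A hAsym z y] at h1
      simpa using h1
    refine ⟨fun i => ?_, hy⟩
    obtain ⟨e, he⟩ := psi_dualBasis_aux A hAdet i
    have hed : InDual A e := by
      intro z hz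
      rw [psi_symm_aux A hAsym e z, he z]
      exact hz i
    have h1 := h (0, e) ⟨fun j => ⟨0, by simp⟩, hed⟩
    have h2 := h1.add_aux (hfiso y e hy hed)
    simp only [psiR, psi_zero_left_aux] at h2
    rw [he x] at h2
    convert h2 using 1
    ring
  · obtain ⟨x, y⟩ := u
    obtain ⟨x', y'⟩ := v
    have h1 := hv.2 x hu.1
    have h2 := hu.2 x' hv.1
    have h3 := (h1.add_aux h2).sub_aux (hfiso y y' hu.2 hv.2)
    simp only [psiR] at h3 ⊢
    rw [psi_symm_aux A hAsym x y', psi_symm_aux A hAsym x' y]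
    convert h3 using 1
    ring
end
end

section
/- Let (H, φ) be a finite linked group, A a non-degenerate n×n linking matrix, and B a non-degenerate m×m linking matrix. Let γ ∈ Hⁿ satisfy φ(γᵢ, γⱼ) = class of (A⁻¹)ᵢⱼ in ℚ/ℤ for all i, j, let η ∈ Hᵐ satisfy φ(ηᵢ, ηⱼ) = class of (B⁻¹)ᵢⱼ in ℚ/ℤ for all i, j, and let U be an n×m integer matrix with γᵢ = Σⱼ Uᵢⱼ ηⱼ in H for all i. Then the rational matrix A⁻¹ − U B⁻¹ Uᵀ has integer entries. -/
open Matrix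

noncomputable section

/-- if `φ(γ i, γ j) = [(A⁻¹) i j]`, `φ(η i, η j) = [(B⁻¹) i j]` in `ℚ/ℤ`
and `γ i = Σⱼ U i j • η j`, then the rational matrix `A⁻¹ − U B⁻¹ Uᵀ` has integer
entries. -/
theorem inv_sub_conj_integral {n m : ℕ} (H : Type) [AddCommGroup H] [Finite H]
    (φ : H → H → QZ)
    (hφsymm : ∀ x y, φ x y = φ y x)
    (hφadd : ∀ x y z, φ (x + y) z = φ x z + φ y z)
    (hφadd' : ∀ x y z, φ x (y + z) = φ x y + φ x z)
    (A : Matrix (Fin n) (Fin n) ℤ) (hAsym : A.IsSymm) (hAdet : A.det ≠ 0)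
    (B : Matrix (Fin m) (Fin m) ℤ) (hBsym : B.IsSymm) (hBdet : B.det ≠ 0)
    (γ : Fin n → H) (hγφ : ∀ i j, φ (γ i) (γ j) = (((mQ A)⁻¹ i j : ℚ) : QZ))
    (η : Fin m → H) (hηφ : ∀ i j, φ (η i) (η j) = (((mQ B)⁻¹ i j : ℚ) : QZ))
    (U : Matrix (Fin n) (Fin m) ℤ) (hU : ∀ i, γ i = ∑ j, U i j • η j) :
    ∀ i j, ∃ a : ℤ, ((mQ A)⁻¹ - mQ U * (mQ B)⁻¹ * (mQ U)ᵀ) i j = a := by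
  intro i j
  let L : H → H →+ QZ := fun z => AddMonoidHom.mk' (fun x => φ x z) (fun x y => hφadd x y z)
  let R : H → H →+ QZ := fun x => AddMonoidHom.mk' (fun z => φ x z) (fun y z => hφadd' x y z)
  have hL : ∀ (c : Fin m → ℤ) z, φ (∑ k, c k • η k) z = ∑ k, c k • φ (η k) z := by
    intro c z
    have h := map_sum (L z) (fun k => c k • η k) Finset.univ
    simp only [map_zsmul] at h
    exact h
  have hR : ∀ (c : Fin m → ℤ) x, φ x (∑ k, c k • η k) = ∑ k, c k • φ x (η k) := by
    intro c x
    have h := map_sum (R x) (fun k => c k • η k) Finset.univ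
    simp only [map_zsmul] at h
    exact h
  let q : ℚ →+ QZ := QuotientAddGroup.mk' (AddSubgroup.zmultiples (1 : ℚ))
  have hq : ∀ x : ℚ, (x : QZ) = q x := fun _ => rfl
  have key : q ((mQ A)⁻¹ i j) = q ((mQ U * (mQ B)⁻¹ * (mQ U)ᵀ) i j) := by
    rw [← hq, ← hγφ, hU i, hU j, hR]
    simp only [hL, hηφ, hq, ← map_zsmul, ← map_sum]
    congr 1
    simp only [Matrix.mul_apply, Matrix.transpose_apply, zsmul_eq_mul]
    refine Finset.sum_congr rfl fun l _ => ?_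
    rw [mul_comm]
    rfl
  have h0 : q (((mQ A)⁻¹ - mQ U * (mQ B)⁻¹ * (mQ U)ᵀ) i j) = 0 := by
    rw [Matrix.sub_apply, map_sub, key, sub_self]
  have h1 := (QuotientAddGroup.eq_zero_iff _).1 h0
  obtain ⟨a, ha⟩ := AddSubgroup.mem_zmultiples_iff.1 h1
  exact ⟨a, by rw [← ha]; simp⟩
end
end

section
/- Let (H, φ) be a finite linked group, A a non-degenerate n×n linking matrix with an A-presentation γ of H, and B a non-degenerate m×m linking matrix with a B-presentation η of H. Let U be an n×m integer matrix and V an m×n integer matrix with γᵢ = Σⱼ Uᵢⱼ ηⱼ and ηᵢ = Σⱼ Vᵢⱼ γⱼ in H for all i. Then the rational matrix B⁻¹ Uᵀ A has integer entries, and there exists an m×n integer matrix G such that V = B⁻¹ Uᵀ A + G·A. -/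
open Matrix

noncomputable section

/-- with `γ` an `A`-presentation and `η` a `B`-presentation of `(H, φ)`,
and integer matrices `U`, `V` with `γ = U·η` and `η = V·γ` in `H`, the rational matrix
`B⁻¹ Uᵀ A` has integer entries and `V = B⁻¹ Uᵀ A + G·A` for some integer matrix `G`. -/
theorem V_eq_F_plus_GA {n m : ℕ} (H : Type) [AddCommGroup H] [Finite H]
    (φ : H → H → QZ)
    (hφsymm : ∀ x y, φ x y = φ y x)
    (hφadd : ∀ x y z, φ (x + y) z = φ x z + φ y z)
    (hφadd' : ∀ x y z, φ x (y + z) = φ x y + φ x z)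
    (A : Matrix (Fin n) (Fin n) ℤ) (hAsym : A.IsSymm) (hAdet : A.det ≠ 0)
    (B : Matrix (Fin m) (Fin m) ℤ) (hBsym : B.IsSymm) (hBdet : B.det ≠ 0)
    (γ : Fin n → H) (hγ : IsPresentation φ A γ)
    (η : Fin m → H) (hη : IsPresentation φ B η)
    (U : Matrix (Fin n) (Fin m) ℤ) (V : Matrix (Fin m) (Fin n) ℤ)
    (hU : ∀ i, γ i = ∑ j, U i j • η j) (hV : ∀ i, η i = ∑ j, V i j • γ j) :
    (∀ i j, ∃ a : ℤ, ((mQ B)⁻¹ * (mQ U)ᵀ * mQ A) i j = a) ∧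
    (∃ G : Matrix (Fin m) (Fin n) ℤ,
      mQ V = (mQ B)⁻¹ * (mQ U)ᵀ * mQ A + mQ G * mQ A) := by
  have key : ∀ i j, ∃ a : ℤ, (a : ℚ) =
      (mQ V * (mQ A)⁻¹) i j - ((mQ B)⁻¹ * (mQ U)ᵀ) i j := by
    intro i j
    let f : H → H →+ QZ := fun z => AddMonoidHom.mk' (fun x => φ x z) (fun x y => hφadd x y z)
    let g : H → H →+ QZ := fun x => AddMonoidHom.mk' (fun z => φ x z) (fun y z => hφadd' x y z)
    have h1 : φ (η i) (γ j) = (((mQ V * (mQ A)⁻¹) i j : ℚ) : QZ) := by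
      have e : φ (η i) (γ j) = f (γ j) (∑ k, V i k • γ k) := by
        rw [← hV i]; rfl
      have e2 : ∀ k, f (γ j) (γ k) = (((mQ A)⁻¹ k j : ℚ) : QZ) := fun k => hγ.2.2 k j
      rw [e, map_sum, Matrix.mul_apply]
      refine Eq.trans ?_ (map_sum (QuotientAddGroup.mk' (AddSubgroup.zmultiples (1 : ℚ))) _ _).symm
      refine Finset.sum_congr rfl fun k _ => ?_
      rw [map_zsmul, e2]
      have : mQ V i k * (mQ A)⁻¹ k j = V i k • (mQ A)⁻¹ k j := by
        simp [mQ, zsmul_eq_mul]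
      rw [this, map_zsmul]; rfl
    have h2 : φ (η i) (γ j) = ((((mQ B)⁻¹ * (mQ U)ᵀ) i j : ℚ) : QZ) := by
      have e : φ (η i) (γ j) = g (η i) (∑ k, U j k • η k) := by
        rw [← hU j]; rfl
      have e2 : ∀ k, g (η i) (η k) = (((mQ B)⁻¹ i k : ℚ) : QZ) := fun k => hη.2.2 i k
      rw [e, map_sum, Matrix.mul_apply]
      refine Eq.trans ?_ (map_sum (QuotientAddGroup.mk' (AddSubgroup.zmultiples (1 : ℚ))) _ _).symm
      refine Finset.sum_congr rfl fun k _ => ?_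
      rw [map_zsmul, e2]
      have : (mQ B)⁻¹ i k * (mQ U)ᵀ k j = U j k • (mQ B)⁻¹ i k := by
        simp [mQ, zsmul_eq_mul, mul_comm]
      rw [this, map_zsmul]; rfl
    have h3 := h2.symm.trans h1
    have h4 := QuotientAddGroup.eq.mp h3
    obtain ⟨a, ha⟩ := AddSubgroup.mem_zmultiples_iff.mp h4
    refine ⟨a, ?_⟩
    rw [zsmul_eq_mul, mul_one] at ha
    rw [ha]; ring
  choose G hG using key
  have hdet : IsUnit (mQ A).det := by
    have : (mQ A).det = ((A.det : ℤ) : ℚ) := (Int.cast_det A).symm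
    rw [this]
    exact isUnit_iff_ne_zero.mpr (Int.cast_ne_zero.mpr hAdet)
  have hGm : mQ (Matrix.of G) = mQ V * (mQ A)⁻¹ - (mQ B)⁻¹ * (mQ U)ᵀ := by
    ext i j
    exact hG i j
  have main : mQ V = (mQ B)⁻¹ * (mQ U)ᵀ * mQ A + mQ (Matrix.of G) * mQ A := by
    rw [hGm, Matrix.sub_mul, Matrix.nonsing_inv_mul_cancel_right _ _ hdet]
    abel
  refine ⟨fun i j => ⟨(V - Matrix.of G * A) i j, ?_⟩, Matrix.of G, main⟩
  rw [eq_sub_of_add_eq main.symm]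
  simp [mQ, Matrix.mul_apply]
end
end
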